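/- arXiv:2401.06988 — 4 statements merged into one kernel-verified Lean document; each statement's English description precedes it below -/
import Mathlib

section
/- Yang–Baxter equation, Γ–Γ case (Proposition 2.1 with (X,Y) = (Γ,Γ)): For all x, y ∈ ℂ (with all denominators nonzero), all colors a, b, d, e ∈ {0} ∪ [±n], and all vectors c, f ∈ ℕ^{2n}, the following identity holds: Σ over g, i ∈ {0}∪[±n] and h ∈ ℕ^{2n} of R_{ΓΓ}(a, b, g, i; x, y) · w^Γ_y(g, h, d, c) · w^Γ_x(i, f, e, h) equals Σ over j, l ∈ {0}∪[±n] and k ∈ ℕ^{2n} of w^Γ_x(b, k, j, c) · w^Γ_y(a, f, l, k) · R_{ΓΓ}(l, j, d, e; x, y). (Only finitely many summands are nonzero, by color conservation.) -/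
open scoped BigOperators

/-- The set of colors `{0} ∪ [±n]`, encoded as `Fin (2*n+1)`:
index `i < n` is the positive color `i+1`, index `n` is the color `0`,
and index `k > n` is the negative color `\overline{2*n+1-k}`.
The order on `Fin (2*n+1)` is exactly the color order
`1 < ⋯ < n < 0 < n̄ < ⋯ < 1̄`. -/
abbrev Col (n : ℕ) := Fin (2*n+1)

/-- The color `0` (identified with the `+` spin). -/
def mid (n : ℕ) : Col n := ⟨n, by omega⟩

/-- The bar involution `i ↦ ī` on colors (fixing `0`). -/
def barC (n : ℕ) (c : Col n) : Col n := ⟨2*n - c.val, by omega⟩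

/-- The positive color `i+1` attached to `i : Fin n`. -/
def posC (n : ℕ) (i : Fin n) : Col n := ⟨i.val, by have := i.isLt; omega⟩

/-- Vectors `I ∈ ℕ^{2n}` indexed by the colors `[±n]` (the entry at the
color `0` is irrelevant/always `0`). -/
abbrev Vec (n : ℕ) := Col n → ℕ

/-- `e_j`: the standard basis vector for `j ∈ [±n]`, and `e_0 = 0`. -/
def eV (n : ℕ) (c : Col n) : Vec n := fun k => if c ≠ mid n ∧ k = c then 1 else 0

/-- `I_{[1,n]}`. -/
def sLo (n : ℕ) (I : Vec n) : ℕ := ∑ k ∈ Finset.univ.filter (fun k : Col n => k < mid n), I k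
/-- `I_{[n̄,1̄]}`. -/
def sHi (n : ℕ) (I : Vec n) : ℕ := ∑ k ∈ Finset.univ.filter (fun k : Col n => mid n < k), I k
/-- `I_{≤ l}`. -/
def sLe (n : ℕ) (I : Vec n) (l : Col n) : ℕ := ∑ k ∈ Finset.univ.filter (fun k : Col n => k ≤ l), I k
/-- `I_{< l}`. -/
def sLt (n : ℕ) (I : Vec n) (l : Col n) : ℕ := ∑ k ∈ Finset.univ.filter (fun k : Col n => k < l), I k
/-- `I_{> l}`. -/
def sGt (n : ℕ) (I : Vec n) (l : Col n) : ℕ := ∑ k ∈ Finset.univ.filter (fun k : Col n => l < k), I k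
/-- `I_{≥ l}`. -/
def sGe (n : ℕ) (I : Vec n) (l : Col n) : ℕ := ∑ k ∈ Finset.univ.filter (fun k : Col n => l ≤ k), I k

/-- The Boltzmann weight `L_x(I, j, K, ℓ)` of a Γ vertex (Table 2.1). -/
noncomputable def LW (n : ℕ) (q s x : ℂ) (I : Vec n) (j : Col n) (K : Vec n) (l : Col n) : ℂ :=
  if ∀ k, I k + eV n j k = K k + eV n l k then
    if j = l then
      if l = mid n then (q ^ (-(sLo n I : ℤ)) - s * x * q ^ (sHi n I : ℤ)) / (1 - s * x)
      else if l < mid n then (s * q ^ (I l : ℤ) - x) * q ^ (-(sLe n I l : ℤ)) / (s * (1 - s * x))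
      else s * (s * q ^ (I l : ℤ) - x) * q ^ (sGt n I l : ℤ) / (1 - s * x)
    else if j < l then
      if l = mid n then (x * q ^ (-(sLo n I : ℤ)) - s ^ 2 * x * q ^ (sHi n I : ℤ)) / (s * (1 - s * x))
      else if l < mid n then -x * (1 - q ^ (I l : ℤ)) * q ^ (-(sLe n I l : ℤ)) / (s * (1 - s * x))
      else -(s * x) * (1 - q ^ (I l : ℤ)) * q ^ (sGt n I l : ℤ) / (1 - s * x)
    else
      if l = mid n then (q ^ (-(sLo n I : ℤ)) - s ^ 2 * q ^ (sHi n I : ℤ)) / (1 - s * x)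
      else if l < mid n then -(1 - q ^ (I l : ℤ)) * q ^ (-(sLe n I l : ℤ)) / (1 - s * x)
      else -(s ^ 2) * (1 - q ^ (I l : ℤ)) * q ^ (sGt n I l : ℤ) / (1 - s * x)
  else 0

/-- Weight of a Γ vertex with west, south, east, north edges `(W, S, E, N)`:
`w^Γ_z(W,S,E,N) = L_z(S, W, N, E)`. -/
noncomputable def wG (n : ℕ) (q s z : ℂ) (W : Col n) (S : Vec n) (E : Col n) (N : Vec n) : ℂ :=
  LW n q s z S W N E

/-- The `Γ-Γ` R-weight `R_{ΓΓ}(α,β,γ,δ; x,y)` (Figure 2.4); positions: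
`α` bottom-left, `β` top-left, `γ` top-right, `δ` bottom-right. -/
noncomputable def RGG (n : ℕ) (q x y : ℂ) (α β γ δ : Col n) : ℂ :=
  if α = β ∧ β = γ ∧ γ = δ then 1
  else if α = γ ∧ β = δ ∧ α < β then (x - y) / (x - q * y)
  else if α = γ ∧ β = δ ∧ β < α then q * (x - y) / (x - q * y)
  else if α = δ ∧ β = γ ∧ β < α then (1 - q) * x / (x - q * y)
  else if α = δ ∧ β = γ ∧ α < β then (1 - q) * y / (x - q * y)
  else 0

/-- Weight of the gap immediately after the color `l`. -/
noncomputable def Aw (n : ℕ) (q s : ℂ) (I : Vec n) (l : Col n) : ℂ :=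
  if l < mid n then q ^ (-(sLe n I l : ℤ)) else s ^ 2 * q ^ (sGt n I l : ℤ)

/-- Weight of the gap immediately before the color `l`. -/
noncomputable def Bw (n : ℕ) (q s : ℂ) (I : Vec n) (l : Col n) : ℂ :=
  if l ≤ mid n then q ^ (-(sLt n I l : ℤ)) else s ^ 2 * q ^ (sGe n I l : ℤ)

/-- Uniform vertex coefficient in terms of gap weights. -/
noncomputable def coefW (n : ℕ) (t : ℂ) (B A : ℂ) (j l : Col n) : ℂ :=
  if j = l then B - t * A else if j < l then t * (B - A) else B - A

lemma sum_add_eV (n : ℕ) (I : Vec n) (j : Col n) (p : Col n → Prop) [DecidablePred p] :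
    ∑ k ∈ Finset.univ.filter p, (I k + eV n j k)
      = ∑ k ∈ Finset.univ.filter p, I k + if j ≠ mid n ∧ p j then 1 else 0 := by
  rw [Finset.sum_add_distrib]
  congr 1
  by_cases hj : j = mid n
  · simp [eV, hj]
  · simp [eV, hj, Finset.sum_ite_eq']

lemma Aw_add (n : ℕ) (q s : ℂ) (hq : q ≠ 0) (I : Vec n) (j l : Col n) :
    Aw n q s (fun k => I k + eV n j k) l
      = Aw n q s I l * (if j ≤ l then q⁻¹ else 1) * (if l < mid n then 1 else q) := by
  unfold Aw sLe sGt
  rw [sum_add_eV, sum_add_eV]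
  by_cases h1 : l < mid n
  · by_cases h2 : j ≤ l
    · have : j ≠ mid n := (lt_of_le_of_lt h2 h1).ne
      simp [h1, h2, this, zpow_add₀ hq, mul_comm]
    · simp [h1, h2]
  · by_cases h2 : j ≤ l
    · simp [h1, h2, not_lt.2 h2, hq]
    · have h3 := not_le.1 h2
      have : j ≠ mid n := (lt_of_le_of_lt (not_lt.1 h1) h3).ne'
      simp [h1, h2, this, h3, zpow_add₀ hq]
      ring

lemma Bw_add (n : ℕ) (q s : ℂ) (hq : q ≠ 0) (I : Vec n) (j l : Col n) :
    Bw n q s (fun k => I k + eV n j k) l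
      = Bw n q s I l * (if j < l then q⁻¹ else 1) * (if l ≤ mid n then 1 else q) := by
  unfold Bw sLt sGe
  rw [sum_add_eV, sum_add_eV]
  by_cases h1 : l ≤ mid n
  · by_cases h2 : j < l
    · have : j ≠ mid n := (lt_of_lt_of_le h2 h1).ne
      simp [h1, h2, this, zpow_add₀ hq, mul_comm]
    · simp [h1, h2]
  · by_cases h2 : j < l
    · simp [h1, h2, not_le.2 h2, hq]
    · have h3 := not_lt.1 h2
      have : j ≠ mid n := (lt_of_lt_of_le (not_le.1 h1) h3).ne'
      simp [h1, h2, this, h3, zpow_add₀ hq]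
      ring

lemma Aw_shift (n : ℕ) (q s : ℂ) (hq : q ≠ 0) (f h : Vec n) (i e l : Col n)
    (H : ∀ k, f k + eV n i k = h k + eV n e k) :
    Aw n q s h l = Aw n q s f l * (if i ≤ l then q⁻¹ else 1) * (if e ≤ l then q else 1) := by
  have h1 := Aw_add n q s hq f i l
  have h2 := Aw_add n q s hq h e l
  rw [funext H, h2] at h1
  have h3 : (if l < mid n then (1:ℂ) else q) ≠ 0 := by split_ifs <;> simp [hq]
  have h4 := mul_right_cancel₀ h3 h1
  rw [← h4]
  split_ifs <;> field_simp

lemma Bw_shift (n : ℕ) (q s : ℂ) (hq : q ≠ 0) (f h : Vec n) (i e l : Col n)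
    (H : ∀ k, f k + eV n i k = h k + eV n e k) :
    Bw n q s h l = Bw n q s f l * (if i < l then q⁻¹ else 1) * (if e < l then q else 1) := by
  have h1 := Bw_add n q s hq f i l
  have h2 := Bw_add n q s hq h e l
  rw [funext H, h2] at h1
  have h3 : (if l ≤ mid n then (1:ℂ) else q) ≠ 0 := by split_ifs <;> simp [hq]
  have h4 := mul_right_cancel₀ h3 h1
  rw [← h4]
  split_ifs <;> field_simp

lemma sLe_eq (n : ℕ) (I : Vec n) (l : Col n) : sLe n I l = sLt n I l + I l := by
  unfold sLe sLt
  have : Finset.univ.filter (fun k : Col n => k ≤ l)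
      = insert l (Finset.univ.filter (fun k : Col n => k < l)) := by
    ext k; simp [le_iff_lt_or_eq, or_comm]
  rw [this, Finset.sum_insert (by simp), add_comm]

lemma sGe_eq (n : ℕ) (I : Vec n) (l : Col n) : sGe n I l = sGt n I l + I l := by
  unfold sGe sGt
  have : Finset.univ.filter (fun k : Col n => l ≤ k)
      = insert l (Finset.univ.filter (fun k : Col n => l < k)) := by
    ext k; simp [le_iff_lt_or_eq, or_comm, eq_comm]
  rw [this, Finset.sum_insert (by simp), add_comm]

lemma LW_eq (n : ℕ) (q s x : ℂ) (hq : q ≠ 0) (hs : s ≠ 0) (hx : 1 - s * x ≠ 0)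
    (I : Vec n) (j : Col n) (K : Vec n) (l : Col n) :
    LW n q s x I j K l = if ∀ k, I k + eV n j k = K k + eV n l k then
      coefW n (x / s) (Bw n q s I l) (Aw n q s I l) j l / (1 - s * x) else 0 := by
  unfold LW
  by_cases h0 : ∀ k, I k + eV n j k = K k + eV n l k
  swap
  · rw [if_neg h0, if_neg h0]
  rw [if_pos h0, if_pos h0]
  rcases lt_trichotomy l (mid n) with hl | hl | hl
  · have hB : Bw n q s I l = q ^ (I l : ℤ) * q ^ (-(sLe n I l : ℤ)) := by
      unfold Bw
      rw [if_pos hl.le, sLe_eq, ← zpow_add₀ hq]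
      congr 1; push_cast; ring
    have hA : Aw n q s I l = q ^ (-(sLe n I l : ℤ)) := by unfold Aw; rw [if_pos hl]
    rw [hA, hB]
    generalize q ^ (-(sLe n I l : ℤ)) = X
    generalize q ^ (I l : ℤ) = Y
    unfold coefW
    simp only [hl.ne, hl, if_true, if_false]
    split_ifs <;> field_simp <;> ring
  · subst hl
    have hB : Bw n q s I (mid n) = q ^ (-(sLo n I : ℤ)) := by
      unfold Bw; rw [if_pos le_rfl]; rfl
    have hA : Aw n q s I (mid n) = s ^ 2 * q ^ (sHi n I : ℤ) := by
      unfold Aw; rw [if_neg (lt_irrefl _)]; rfl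
    rw [hA, hB]
    generalize q ^ (-(sLo n I : ℤ)) = X
    generalize q ^ (sHi n I : ℤ) = Y
    unfold coefW
    simp only [if_true]
    split_ifs <;> field_simp
  · have hB : Bw n q s I l = s ^ 2 * (q ^ (I l : ℤ) * q ^ (sGt n I l : ℤ)) := by
      unfold Bw
      rw [if_neg (not_le.2 hl), sGe_eq, ← zpow_add₀ hq]
      congr 2; push_cast; ring
    have hA : Aw n q s I l = s ^ 2 * q ^ (sGt n I l : ℤ) := by
      unfold Aw; rw [if_neg hl.not_gt]
    rw [hA, hB]
    generalize q ^ (sGt n I l : ℤ) = X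
    generalize q ^ (I l : ℤ) = Y
    unfold coefW
    simp only [hl.ne', hl.not_gt, if_false]
    split_ifs <;> field_simp <;> ring

lemma Bw_eq_Aw (n : ℕ) (q s : ℂ) (I : Vec n) (l : Col n) (hl : l ≠ mid n) (h0 : I l = 0) :
    Bw n q s I l = Aw n q s I l := by
  unfold Bw Aw
  rw [sLe_eq, sGe_eq, h0]
  rcases lt_or_gt_of_ne hl with h | h
  · simp [h, h.le]
  · simp [h.not_gt, h.not_ge]

/-- Product of two vertex coefficients stacked in a column, with bottom vector `f`. -/
noncomputable def colW (n : ℕ) (q s x y : ℂ) (f : Vec n) (i e g d : Col n) : ℂ :=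
  (coefW n (x / s) (Bw n q s f e) (Aw n q s f e) i e / (1 - s * x)) *
  (coefW n (y / s)
    (Bw n q s f d * (if i < d then q⁻¹ else 1) * (if e < d then q else 1))
    (Aw n q s f d * (if i ≤ d then q⁻¹ else 1) * (if e ≤ d then q else 1)) g d / (1 - s * y))

lemma finsum_col (n : ℕ) (q s x y : ℂ) (hq : q ≠ 0) (hs : s ≠ 0)
    (hx : 1 - s * x ≠ 0) (hy : 1 - s * y ≠ 0) (f c : Vec n) (i e g d : Col n) :
    ∑ᶠ h : Vec n, wG n q s x i f e h * wG n q s y g h d c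
      = if ∀ k, f k + eV n i k + eV n g k = c k + eV n e k + eV n d k then
        colW n q s x y f i e g d else 0 := by
  unfold wG
  by_cases hex : ∃ h : Vec n, ∀ k, f k + eV n i k = h k + eV n e k
  · obtain ⟨h, hh⟩ := hex
    rw [finsum_eq_single _ h]
    · rw [LW_eq n q s x hq hs hx, LW_eq n q s y hq hs hy, if_pos hh,
        Aw_shift n q s hq f h i e d hh, Bw_shift n q s hq f h i e d hh]
      have : (∀ k, h k + eV n g k = c k + eV n d k) ↔
          (∀ k, f k + eV n i k + eV n g k = c k + eV n e k + eV n d k) := by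
        refine forall_congr' fun k => ?_
        have := hh k
        omega
      simp only [this]
      by_cases hc : ∀ k, f k + eV n i k + eV n g k = c k + eV n e k + eV n d k
      · rw [if_pos hc, if_pos hc]; rfl
      · rw [if_neg hc, if_neg hc, mul_zero]
    · intro h' hne
      rw [LW_eq n q s x hq hs hx, if_neg, zero_mul]
      intro hh'
      apply hne
      funext k
      have h1 := hh k
      have h2 := hh' k
      omega
  · have hz : ∀ h : Vec n, LW n q s x f i h e * LW n q s y h g c d = 0 := by
      intro h
      rw [LW_eq n q s x hq hs hx, if_neg (fun hh => hex ⟨h, hh⟩), zero_mul]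
    simp only [hz, finsum_zero]
    have hie : i ≠ e := by
      rintro rfl
      exact hex ⟨f, fun k => rfl⟩
    have hem : e ≠ mid n := by
      rintro rfl
      exact hex ⟨fun k => f k + eV n i k, fun k => by simp [eV]⟩
    have hfe : f e = 0 := by
      by_contra hfe
      refine hex ⟨fun k => f k + eV n i k - eV n e k, fun k => ?_⟩
      have : eV n e k ≤ f k := by
        unfold eV
        split_ifs with hk
        · rw [hk.2]; omega
        · omega
      dsimp only
      omega
    have : colW n q s x y f i e g d = 0 := by
      unfold colW
      rw [Bw_eq_Aw n q s f e hem hfe]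
      simp [coefW, hie]
    simp [this]

lemma sum_R_left (n : ℕ) (q x y : ℂ) (a b : Col n) (F : Col n → Col n → ℂ) :
    ∑ g : Col n, ∑ i : Col n, RGG n q x y a b g i * F g i
      = if a = b then F a a else
        RGG n q x y a b a b * F a b + RGG n q x y a b b a * F b a := by
  rw [← Finset.sum_product' (f := fun g i => RGG n q x y a b g i * F g i)]
  split_ifs with h
  · subst h
    rw [Finset.sum_eq_single (a, a)]
    · simp [RGG]
    · rintro ⟨g, i⟩ - hne
      have : RGG n q x y a a g i = 0 := by
        unfold RGG
        rw [if_neg (fun h => hne (by rw [← h.2.2, ← h.2.1])), if_neg, if_neg, if_neg, if_neg] <;>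
          simp
      simp [this]
    · simp
  · rw [Finset.univ_product_univ, ← Finset.sum_subset (Finset.subset_univ {(a, b), (b, a)}),
      Finset.sum_pair (fun hh => h (Prod.mk.inj hh).1)]
    rintro ⟨g, i⟩ - hne
    simp only [Finset.mem_insert, Finset.mem_singleton, Prod.mk.injEq, not_or] at hne
    have : RGG n q x y a b g i = 0 := by
      unfold RGG
      rw [if_neg, if_neg, if_neg, if_neg, if_neg] <;> grind
    simp [this]

lemma sum_R_right (n : ℕ) (q x y : ℂ) (d e : Col n) (F : Col n → Col n → ℂ) :
    ∑ j : Col n, ∑ l : Col n, F j l * RGG n q x y l j d e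
      = if d = e then F d d else
        F e d * RGG n q x y d e d e + F d e * RGG n q x y e d d e := by
  rw [← Finset.sum_product' (f := fun j l => F j l * RGG n q x y l j d e)]
  split_ifs with h
  · subst h
    rw [Finset.sum_eq_single (d, d)]
    · simp [RGG]
    · rintro ⟨j, l⟩ - hne
      have : RGG n q x y l j d d = 0 := by
        unfold RGG
        rw [if_neg, if_neg, if_neg, if_neg, if_neg] <;> grind
      simp [this]
    · simp
  · rw [Finset.univ_product_univ, ← Finset.sum_subset (Finset.subset_univ {(e, d), (d, e)}),
      Finset.sum_pair (fun hh => h (Prod.mk.inj hh).2)]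
    rintro ⟨j, l⟩ - hne
    simp only [Finset.mem_insert, Finset.mem_singleton, Prod.mk.injEq, not_or] at hne
    have : RGG n q x y l j d e = 0 := by
      unfold RGG
      rw [if_neg, if_neg, if_neg, if_neg, if_neg] <;> grind
    simp [this]

lemma R_lt (n : ℕ) (q x y : ℂ) (a b : Col n) (h : a < b) :
    RGG n q x y a b a b = (x - y) / (x - q * y) ∧
    RGG n q x y a b b a = (1 - q) * y / (x - q * y) ∧
    RGG n q x y b a b a = q * (x - y) / (x - q * y) ∧
    RGG n q x y b a a b = (1 - q) * x / (x - q * y) := by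
  unfold RGG
  simp [h, h.ne, h.ne', h.not_gt]

lemma tri {α : Type*} [LinearOrder α] (a b : α) :
    (a < b ∧ a ≠ b ∧ b ≠ a ∧ ¬ b < a ∧ a ≤ b ∧ ¬ b ≤ a) ∨ a = b ∨
    (b < a ∧ b ≠ a ∧ a ≠ b ∧ ¬ a < b ∧ b ≤ a ∧ ¬ a ≤ b) := by
  rcases lt_trichotomy a b with h | h | h
  · exact Or.inl ⟨h, h.ne, h.ne', h.not_gt, h.le, h.not_ge⟩
  · exact Or.inr (Or.inl h)
  · exact Or.inr (Or.inr ⟨h, h.ne, h.ne', h.not_gt, h.le, h.not_ge⟩)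

set_option maxHeartbeats 40000000 in
lemma core (n : ℕ) (q s x y : ℂ) (hq : q ≠ 0) (hs : s ≠ 0)
    (hx : 1 - s * x ≠ 0) (hy : 1 - s * y ≠ 0) (hR : x - q * y ≠ 0)
    (a b d e : Col n) (f : Vec n) :
    (if a = b then colW n q s x y f a e a d else
        RGG n q x y a b a b * colW n q s x y f b e a d
          + RGG n q x y a b b a * colW n q s x y f a e b d)
      = if d = e then colW n q s y x f a d b d else
        colW n q s y x f a d b e * RGG n q x y d e d e
          + colW n q s y x f a e b d * RGG n q x y e d d e := by
  unfold colW RGG coefW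
  generalize hDx : 1 - s * x = Dx at *
  generalize hDy : 1 - s * y = Dy at *
  generalize hDR : x - q * y = DR at *
  have t1 := tri d e
  have t2 := tri a b
  have t3 := tri a d
  have t4 := tri a e
  have t5 := tri b d
  have t6 := tri b e
  rcases t1 with h1 | h1 | h1 <;> (try subst h1) <;>
  rcases t2 with h2 | h2 | h2 <;> (try subst h2) <;>
  rcases t3 with h3 | h3 | h3 <;> (try subst h3) <;> (try (exfalso; order)) <;>
  rcases t4 with h4 | h4 | h4 <;> (try subst h4) <;> (try (exfalso; order)) <;>
  rcases t5 with h5 | h5 | h5 <;> (try subst h5) <;> (try (exfalso; order)) <;>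
  rcases t6 with h6 | h6 | h6 <;> (try subst h6) <;> (try (exfalso; order)) <;>
  simp only [*, if_true, if_false, and_true, and_false, and_self,
    lt_irrefl, le_refl] <;>
  field_simp <;> subst hDR <;> ring

/-- Yang–Baxter equation, Γ–Γ case. -/
theorem yang_baxter_gamma_gamma (n : ℕ) (hn : 0 < n) (q s x y : ℂ)
    (hq : q ≠ 0) (hs : s ≠ 0) (hx : 1 - s * x ≠ 0) (hy : 1 - s * y ≠ 0)
    (hR : x - q * y ≠ 0)
    (a b d e : Col n) (c f : Vec n) :
    ∑ g : Col n, ∑ i : Col n, ∑ᶠ h : Vec n,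
        RGG n q x y a b g i * wG n q s y g h d c * wG n q s x i f e h
      = ∑ j : Col n, ∑ l : Col n, ∑ᶠ k : Vec n,
        wG n q s x b k j c * wG n q s y a f l k * RGG n q x y l j d e := by
  have hL : ∀ g i : Col n, ∑ᶠ h : Vec n,
        RGG n q x y a b g i * wG n q s y g h d c * wG n q s x i f e h
      = RGG n q x y a b g i *
        (if ∀ k, f k + eV n i k + eV n g k = c k + eV n e k + eV n d k then
          colW n q s x y f i e g d else 0) := by
    intro g i
    rw [← finsum_col n q s x y hq hs hx hy, ← smul_eq_mul, smul_finsum]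
    refine finsum_congr fun h => ?_
    rw [smul_eq_mul]; ring
  have hRt : ∀ j l : Col n, ∑ᶠ k : Vec n,
        wG n q s x b k j c * wG n q s y a f l k * RGG n q x y l j d e
      = (if ∀ k, f k + eV n a k + eV n b k = c k + eV n l k + eV n j k then
          colW n q s y x f a l b j else 0) * RGG n q x y l j d e := by
    intro j l
    rw [← finsum_col n q s y x hq hs hy hx, mul_comm, ← smul_eq_mul, smul_finsum]
    refine finsum_congr fun h => ?_
    rw [smul_eq_mul]; ring
  simp only [hL, hRt]
  rw [sum_R_left n q x y a b (fun g i =>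
      if ∀ k, f k + eV n i k + eV n g k = c k + eV n e k + eV n d k then
          colW n q s x y f i e g d else 0),
    sum_R_right n q x y d e (fun j l =>
      if ∀ k, f k + eV n a k + eV n b k = c k + eV n l k + eV n j k then
          colW n q s y x f a l b j else 0)]
  have key := core n q s x y hq hs hx hy hR a b d e f
  by_cases H : ∀ k, f k + eV n a k + eV n b k = c k + eV n d k + eV n e k
  · have H1 : ∀ k, f k + eV n a k + eV n b k = c k + eV n e k + eV n d k :=
      fun k => by rw [H k]; ring
    have H2 : ∀ k, f k + eV n b k + eV n a k = c k + eV n e k + eV n d k :=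
      fun k => by rw [← H1 k]; ring
    rw [if_pos H, if_pos H1, if_pos H2, if_pos H1]
    by_cases hab : a = b
    · subst hab
      rw [if_pos H1]
      by_cases hde : d = e
      · subst hde; rw [if_pos H]; exact key
      · rw [if_neg hde] at key ⊢; exact key
    · rw [if_neg hab] at key ⊢
      by_cases hde : d = e
      · subst hde; rw [if_pos H]; exact key
      · rw [if_neg hde] at key ⊢; exact key
  · have H1 : ¬ ∀ k, f k + eV n a k + eV n b k = c k + eV n e k + eV n d k :=
      fun h => H fun k => by rw [h k]; ring
    have H2 : ¬ ∀ k, f k + eV n b k + eV n a k = c k + eV n e k + eV n d k :=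
      fun h => H1 fun k => by rw [← h k]; ring
    rw [if_neg H, if_neg H1, if_neg H2, if_neg H1]
    have z1 : a = b → ¬ ∀ k, f k + eV n a k + eV n a k = c k + eV n e k + eV n d k := by
      rintro rfl; exact H1
    have z2 : d = e → ¬ ∀ k, f k + eV n a k + eV n b k = c k + eV n d k + eV n d k := by
      rintro rfl; exact H
    by_cases hab : a = b <;> by_cases hde : d = e
    · rw [if_pos hab, if_pos hde, if_neg (z1 hab), if_neg (z2 hde)]
    · rw [if_pos hab, if_neg hde, if_neg (z1 hab)]; ring
    · rw [if_neg hab, if_pos hde, if_neg (z2 hde)]; ring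
    · rw [if_neg hab, if_neg hde]; ring
end

section
/- Yang–Baxter equation, Δ–Γ case (Proposition 2.1 with (X,Y) = (Δ,Γ)): For all x, y ∈ ℂ (with all denominators nonzero), all colors a, b, d, e ∈ {0} ∪ [±n], and all vectors c, f ∈ ℕ^{2n}, the following identity holds: Σ over g, i ∈ {0}∪[±n] and h ∈ ℕ^{2n} of R_{ΔΓ}(a, b, g, i; x, y) · w^Γ_y(g, h, d, c) · w^Δ_x(i, f, e, h) equals Σ over j, l ∈ {0}∪[±n] and k ∈ ℕ^{2n} of w^Δ_x(b, k, j, c) · w^Γ_y(a, f, l, k) · R_{ΔΓ}(l, j, d, e; x, y). Here the lower row vertex is a Δ vertex with spectral parameter x and the upper row vertex is a Γ vertex with spectral parameter y. (Only finitely many summands are nonzero, by color conservation.) -/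
open scoped BigOperators

/-- The Boltzmann weight `M_x(I, j, K, ℓ)` of a Δ vertex (Table 2.2). -/
noncomputable def MW (n : ℕ) (q s x : ℂ) (I : Vec n) (j : Col n) (K : Vec n) (l : Col n) : ℂ :=
  if ∀ k, I k + eV n j k = K k + eV n l k then
    if j = l then
      if l = mid n then (q ^ (-(sHi n I : ℤ)) - s * x * q ^ (sLo n I : ℤ)) / (1 - s * x)
      else if l < mid n then s * (s * q ^ (I l : ℤ) - x) * q ^ (sLt n I l : ℤ) / (1 - s * x)
      else (1 - s⁻¹ * x * q ^ (-(I l : ℤ))) * q ^ (-(sGt n I l : ℤ)) / (1 - s * x)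
    else if j < l then
      if l = mid n then (q ^ (-(sHi n I : ℤ)) - s ^ 2 * q ^ (sLo n I : ℤ)) / (1 - s * x)
      else if l < mid n then -(s ^ 2) * (1 - q ^ (I l : ℤ)) * q ^ (sLt n I l : ℤ) / (1 - s * x)
      else -(1 - q ^ (I l : ℤ)) * q ^ (-(sGe n I l : ℤ)) / (1 - s * x)
    else
      if l = mid n then x * (s⁻¹ * q ^ (-(sHi n I : ℤ)) - s * q ^ (sLo n I : ℤ)) / (1 - s * x)
      else if l < mid n then -(s * x) * (1 - q ^ (I l : ℤ)) * q ^ (sLt n I l : ℤ) / (1 - s * x)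
      else -(s⁻¹ * x) * (1 - q ^ (I l : ℤ)) * q ^ (-(sGe n I l : ℤ)) / (1 - s * x)
  else 0

/-- Weight of a Δ vertex with west, south, east, north edges `(W, S, E, N)`:
`w^Δ_z(W,S,E,N) = M_z(S, E, N, W)`. -/
noncomputable def wD (n : ℕ) (q s z : ℂ) (W : Col n) (S : Vec n) (E : Col n) (N : Vec n) : ℂ :=
  MW n q s z S E N W

/-- The `Δ-Γ` R-weight `R_{ΔΓ}(α,β,γ,δ; x,y)` (Figure 2.5); positions:
`α` bottom-left, `β` top-left, `γ` top-right, `δ` bottom-right. -/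
noncomputable def RDG (n : ℕ) (q x y : ℂ) (α β γ δ : Col n) : ℂ :=
  if α = β ∧ β = γ ∧ γ = δ then 1
  else if α = γ ∧ β = δ ∧ α < β then (q * x * y - 1) / (x * y - 1)
  else if α = γ ∧ β = δ ∧ β < α then (q * x * y - 1) / (q * (x * y - 1))
  else if α = β ∧ γ = δ ∧ γ < α then (1 - q) / (q * (x * y - 1))
  else if α = β ∧ γ = δ ∧ α < γ then (1 - q) * x * y / (x * y - 1)
  else 0


namespace YB

noncomputable def sh (q : ℂ) (A : ℕ → ℂ) (e i k : ℕ) : ℂ :=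
  A k * (if e < k then q⁻¹ else 1) * (if i < k then q else 1)

noncomputable def Lh (v : ℂ) (A : ℕ → ℂ) (j l : ℕ) : ℂ :=
  if j = l then A l - v * A (l+1) else (if j < l then v else 1) * (A l - A (l+1))

noncomputable def Mh (u : ℂ) (A : ℕ → ℂ) (j l : ℕ) : ℂ :=
  if j = l then (A (l+1))⁻¹ - u * (A l)⁻¹
  else (if j < l then 1 else u) * ((A (l+1))⁻¹ - (A l)⁻¹)

noncomputable def RD (q w : ℂ) (a b : ℕ) : ℂ :=
  if a < b then (q * w - 1) / (w - 1) else (q * w - 1) / (q * (w - 1))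

noncomputable def RS (q w : ℂ) (a g : ℕ) : ℂ :=
  if a = g then 1 else if g < a then (1 - q) / (q * (w - 1)) else (1 - q) * w / (w - 1)

set_option maxHeartbeats 4000000 in
theorem case1 (q u v w : ℂ) (hq : q ≠ 0) (hw : w - 1 ≠ 0) (A : ℕ → ℂ) (hA : ∀ k, A k ≠ 0)
    (a b d e : ℕ) (hab : a ≠ b) (hde : d ≠ e) :
    RD q w a b * Lh v (sh q A e b) a d * Mh u A e b
      = Mh u (sh q A a d) e b * Lh v A a d * RD q w d e := by
  have h1 := hA b
  have h2 := hA (b+1)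
  have h3 := hA d
  have h4 := hA (d+1)
  unfold RD Lh Mh sh
  rcases lt_trichotomy a b with h | h | h <;> rcases lt_trichotomy d e with h' | h' | h' <;>
  rcases lt_trichotomy a d with k | k | k <;> rcases lt_trichotomy e b with k' | k' | k' <;>
  rcases lt_trichotomy b d with l | l | l <;> rcases lt_trichotomy a e with l' | l' | l' <;>
  first
  | omega
  | (try subst k)
    (try subst k')
    (try subst l)
    (try subst l')
    simp (disch := omega) only [if_pos, if_neg, if_true]
    field_simp

theorem tele_Ico (F B : ℕ → ℂ) (c : ℂ) (p r : ℕ) (hpr : p ≤ r)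
    (h : ∀ g, p ≤ g → g < r → F g = c * (B (g+1) - B g)) :
    ∑ g ∈ Finset.Ico p r, F g = c * (B r - B p) := by
  rw [Finset.sum_congr rfl (fun g hg => h g (Finset.mem_Ico.1 hg).1 (Finset.mem_Ico.1 hg).2),
    ← Finset.mul_sum, Finset.sum_Ico_sub B hpr]

theorem tele1 (F B : ℕ → ℂ) (c0 c1 : ℂ) (p m : ℕ) (hp : p < m)
    (h0 : ∀ g, g < p → F g = c0 * (B (g+1) - B g))
    (h1 : ∀ g, p < g → g < m → F g = c1 * (B (g+1) - B g)) :
    ∑ g ∈ Finset.range m, F g = c0 * (B p - B 0) + F p + c1 * (B m - B (p+1)) := by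
  rw [Finset.range_eq_Ico, ← Finset.sum_Ico_consecutive F (Nat.zero_le p) hp.le,
    Finset.sum_eq_sum_Ico_succ_bot hp,
    tele_Ico F B c0 0 p (Nat.zero_le p) (fun g _ hg => h0 g hg),
    tele_Ico F B c1 (p+1) m hp (fun g hg hg' => h1 g hg hg')]
  ring

theorem tele2 (F B : ℕ → ℂ) (c0 c1 c2 : ℂ) (p r m : ℕ) (hpr : p < r) (hr : r < m)
    (h0 : ∀ g, g < p → F g = c0 * (B (g+1) - B g))
    (h1 : ∀ g, p < g → g < r → F g = c1 * (B (g+1) - B g))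
    (h2 : ∀ g, r < g → g < m → F g = c2 * (B (g+1) - B g)) :
    ∑ g ∈ Finset.range m, F g = c0 * (B p - B 0) + F p + c1 * (B r - B (p+1)) + F r
      + c2 * (B m - B (r+1)) := by
  rw [Finset.range_eq_Ico, ← Finset.sum_Ico_consecutive F (Nat.zero_le r) hr.le,
    Finset.sum_eq_sum_Ico_succ_bot hr,
    ← Finset.range_eq_Ico, tele1 F B c0 c1 p r hpr h0 h1,
    tele_Ico F B c2 (r+1) m hr (fun g hg hg' => h2 g hg hg')]
  ring

theorem tele3 (F B : ℕ → ℂ) (c0 c1 c2 c3 : ℂ) (p r z m : ℕ) (hpr : p < r) (hr : r < z) (hz : z < m)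
    (h0 : ∀ g, g < p → F g = c0 * (B (g+1) - B g))
    (h1 : ∀ g, p < g → g < r → F g = c1 * (B (g+1) - B g))
    (h2 : ∀ g, r < g → g < z → F g = c2 * (B (g+1) - B g))
    (h3 : ∀ g, z < g → g < m → F g = c3 * (B (g+1) - B g)) :
    ∑ g ∈ Finset.range m, F g = c0 * (B p - B 0) + F p + c1 * (B r - B (p+1)) + F r
      + c2 * (B z - B (r+1)) + F z + c3 * (B m - B (z+1)) := by
  rw [Finset.range_eq_Ico, ← Finset.sum_Ico_consecutive F (Nat.zero_le z) hz.le,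
    Finset.sum_eq_sum_Ico_succ_bot hz,
    ← Finset.range_eq_Ico, tele2 F B c0 c1 c2 p r z hpr hr h0 h1 h2,
    tele_Ico F B c3 (z+1) m hz (fun g hg hg' => h3 g hg hg')]
  ring

/-- left summand -/
noncomputable def FL (q u v w : ℂ) (A : ℕ → ℂ) (a d e g : ℕ) : ℂ :=
  RS q w a g * Lh v (sh q A e g) g d * Mh u A e g

/-- right summand -/
noncomputable def FR (q u v w : ℂ) (A : ℕ → ℂ) (a b d l : ℕ) : ℂ :=
  Mh u (sh q A a l) l b * Lh v A a l * RS q w l d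

/-- coefficient of the left summand on an interval; Booleans: `g<a`, `g<d`, `g<e` -/
noncomputable def cL (q u v w : ℂ) (A : ℕ → ℂ) (d e : ℕ) (x y z : Bool) : ℂ :=
  (if x then (1 - q) / (q * (w - 1)) else (1 - q) * w / (w - 1)) *
  ((if y then v else 1) * (A d * (if e < d then q⁻¹ else 1) * (if y then q else 1)
     - A (d+1) * (if e < d + 1 then q⁻¹ else 1) * (if y then q else 1))) *
  (if z then u else 1)

/-- coefficient of the right summand on an interval; Booleans: `l<a`, `l<b`, `l<d` -/
noncomputable def cR (q u v w : ℂ) (A : ℕ → ℂ) (a b : ℕ) (x y z : Bool) : ℂ :=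
  -((if z then (1 - q) * w / (w - 1) else (1 - q) / (q * (w - 1))) *
  ((if y then 1 else u) *
    ((A (b+1) * (if a < b + 1 then q⁻¹ else 1) * (if y then q else 1))⁻¹
     - (A b * (if a < b then q⁻¹ else 1) * (if y then q else 1))⁻¹)) *
  (if x then 1 else v))

theorem FL_eq (q u v w : ℂ) (A : ℕ → ℂ) (a d e g : ℕ) (x y z : Bool)
    (hx : if x then g < a else a < g) (hy : if y then g < d else d < g)
    (hz : if z then g < e else e < g) :
    FL q u v w A a d e g = cL q u v w A d e x y z *
      ((fun k => (A k)⁻¹) (g+1) - (fun k => (A k)⁻¹) g) := by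
  unfold FL cL RS Lh Mh sh
  cases x <;> cases y <;> cases z <;> simp only [if_true, if_false, Bool.false_eq_true] at * <;>
  simp (disch := omega) only [if_pos, if_neg] <;> ring

theorem FR_eq (q u v w : ℂ) (A : ℕ → ℂ) (a b d l : ℕ) (x y z : Bool)
    (hx : if x then l < a else a < l) (hy : if y then l < b else b < l)
    (hz : if z then l < d else d < l) :
    FR q u v w A a b d l = cR q u v w A a b x y z * (A (l+1) - A l) := by
  unfold FR cR RS Lh Mh sh
  cases x <;> cases y <;> cases z <;> simp only [if_true, if_false, Bool.false_eq_true] at * <;>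
  simp (disch := omega) only [if_pos, if_neg] <;> ring

set_option maxHeartbeats 8000000 in
theorem case2 (q t u v : ℂ) (hq : q ≠ 0) (ht : t ≠ 0) (hw : t * u * v - 1 ≠ 0)
    (A : ℕ → ℂ) (hA : ∀ k, A k ≠ 0) (m : ℕ) (hm : A m = t * A 0)
    (a d e : ℕ) (hde : d ≠ e) (ham : a < m) (hdm : d < m) (hem : e < m) :
    ∑ g ∈ Finset.range m, FL q u v (t * u * v) A a d e g
      = Mh u (sh q A a d) e a * Lh v A a d * RD q (t * u * v) d e := by
  let B : ℕ → ℂ := fun k => (A k)⁻¹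
  let c := cL q u v (t * u * v) A d e
  have H : (a < d ∧ d < e) ∨
      (a < e ∧ e < d) ∨
      (d < a ∧ a < e) ∨
      (d < e ∧ e < a) ∨
      (d < a ∧ a = e) ∨
      (e < a ∧ a < d) ∨
      (e < d ∧ d < a) ∨
      (e < a ∧ a = d) ∨
      (a < e ∧ a = d) ∨
      (a < d ∧ a = e) := by omega
  rcases H with ⟨h0, h1⟩ | ⟨h0, h1⟩ | ⟨h0, h1⟩ | ⟨h0, h1⟩ | ⟨h0, rfl⟩ | ⟨h0, h1⟩ | ⟨h0, h1⟩ | ⟨h0, rfl⟩ | ⟨h0, rfl⟩ | ⟨h0, rfl⟩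
  · rw [tele3 (FL q u v (t * u * v) A a d e) B (c true true true) (c false true true) (c false false true) (c false false false) a d e m]
    all_goals first | omega | (intros; apply FL_eq <;> simp <;> omega) | skip
    simp only [B, c, hm]
    unfold cL FL RS RD Lh Mh sh
    simp (disch := omega) only [if_pos, if_neg, if_true, if_false, Bool.false_eq_true]
    field_simp [hA]
    ring1
  · rw [tele3 (FL q u v (t * u * v) A a d e) B (c true true true) (c false true true) (c false true false) (c false false false) a e d m]
    all_goals first | omega | (intros; apply FL_eq <;> simp <;> omega) | skip
    simp only [B, c, hm]
    unfold cL FL RS RD Lh Mh sh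
    simp (disch := omega) only [if_pos, if_neg, if_true, if_false, Bool.false_eq_true]
    field_simp [hA]
    ring1
  · rw [tele3 (FL q u v (t * u * v) A a d e) B (c true true true) (c true false true) (c false false true) (c false false false) d a e m]
    all_goals first | omega | (intros; apply FL_eq <;> simp <;> omega) | skip
    simp only [B, c, hm]
    unfold cL FL RS RD Lh Mh sh
    simp (disch := omega) only [if_pos, if_neg, if_true, if_false, Bool.false_eq_true]
    field_simp [hA]
    ring1
  · rw [tele3 (FL q u v (t * u * v) A a d e) B (c true true true) (c true false true) (c true false false) (c false false false) d e a m]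
    all_goals first | omega | (intros; apply FL_eq <;> simp <;> omega) | skip
    simp only [B, c, hm]
    unfold cL FL RS RD Lh Mh sh
    simp (disch := omega) only [if_pos, if_neg, if_true, if_false, Bool.false_eq_true]
    field_simp [hA]
    ring1
  · rw [tele2 (FL q u v (t * u * v) A a d a) B (c true true true) (c true false true) (c false false false) d a m]
    all_goals first | omega | (intros; apply FL_eq <;> simp <;> omega) | skip
    simp only [B, c, hm]
    unfold cL FL RS RD Lh Mh sh
    simp (disch := omega) only [if_pos, if_neg, if_true, if_false, Bool.false_eq_true]
    field_simp [hA]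
    ring1
  · rw [tele3 (FL q u v (t * u * v) A a d e) B (c true true true) (c true true false) (c false true false) (c false false false) e a d m]
    all_goals first | omega | (intros; apply FL_eq <;> simp <;> omega) | skip
    simp only [B, c, hm]
    unfold cL FL RS RD Lh Mh sh
    simp (disch := omega) only [if_pos, if_neg, if_true, if_false, Bool.false_eq_true]
    field_simp [hA]
    ring1
  · rw [tele3 (FL q u v (t * u * v) A a d e) B (c true true true) (c true true false) (c true false false) (c false false false) e d a m]
    all_goals first | omega | (intros; apply FL_eq <;> simp <;> omega) | skip
    simp only [B, c, hm]
    unfold cL FL RS RD Lh Mh sh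
    simp (disch := omega) only [if_pos, if_neg, if_true, if_false, Bool.false_eq_true]
    field_simp [hA]
    ring1
  · rw [tele2 (FL q u v (t * u * v) A a a e) B (c true true true) (c true true false) (c false false false) e a m]
    all_goals first | omega | (intros; apply FL_eq <;> simp <;> omega) | skip
    simp only [B, c, hm]
    unfold cL FL RS RD Lh Mh sh
    simp (disch := omega) only [if_pos, if_neg, if_true, if_false, Bool.false_eq_true]
    field_simp [hA]
    ring1
  · rw [tele2 (FL q u v (t * u * v) A a a e) B (c true true true) (c false false true) (c false false false) a e m]
    all_goals first | omega | (intros; apply FL_eq <;> simp <;> omega) | skip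
    simp only [B, c, hm]
    unfold cL FL RS RD Lh Mh sh
    simp (disch := omega) only [if_pos, if_neg, if_true, if_false, Bool.false_eq_true]
    field_simp [hA]
    ring1
  · rw [tele2 (FL q u v (t * u * v) A a d a) B (c true true true) (c false true false) (c false false false) a d m]
    all_goals first | omega | (intros; apply FL_eq <;> simp <;> omega) | skip
    simp only [B, c, hm]
    unfold cL FL RS RD Lh Mh sh
    simp (disch := omega) only [if_pos, if_neg, if_true, if_false, Bool.false_eq_true]
    field_simp [hA]
    ring1

set_option maxHeartbeats 8000000 in
theorem case3 (q t u v : ℂ) (hq : q ≠ 0) (ht : t ≠ 0) (hw : t * u * v - 1 ≠ 0)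
    (A : ℕ → ℂ) (hA : ∀ k, A k ≠ 0) (m : ℕ) (hm : A m = t * A 0)
    (a b d : ℕ) (hab : a ≠ b) (ham : a < m) (hbm : b < m) (hdm : d < m) :
    ∑ l ∈ Finset.range m, FR q u v (t * u * v) A a b d l
      = RD q (t * u * v) a b * Lh v (sh q A d b) a d * Mh u A d b := by
  let B : ℕ → ℂ := A
  let c := cR q u v (t * u * v) A a b
  have H : (a < b ∧ b < d) ∨
      (a < d ∧ d < b) ∨
      (a < b ∧ b = d) ∨
      (b < a ∧ a < d) ∨
      (b < d ∧ d < a) ∨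
      (b < a ∧ a = d) ∨
      (d < a ∧ a < b) ∨
      (d < b ∧ b < a) ∨
      (a < b ∧ a = d) ∨
      (b < a ∧ b = d) := by omega
  rcases H with ⟨h0, h1⟩ | ⟨h0, h1⟩ | ⟨h0, rfl⟩ | ⟨h0, h1⟩ | ⟨h0, h1⟩ | ⟨h0, rfl⟩ | ⟨h0, h1⟩ | ⟨h0, h1⟩ | ⟨h0, rfl⟩ | ⟨h0, rfl⟩
  · rw [tele3 (FR q u v (t * u * v) A a b d) B (c true true true) (c false true true) (c false false true) (c false false false) a b d m]
    all_goals first | omega | (intros; apply FR_eq <;> simp <;> omega) | skip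
    simp only [B, c, hm]
    unfold cR FR RS RD Lh Mh sh
    simp (disch := omega) only [if_pos, if_neg, if_true, if_false, Bool.false_eq_true]
    field_simp [hA]
    ring1
  · rw [tele3 (FR q u v (t * u * v) A a b d) B (c true true true) (c false true true) (c false true false) (c false false false) a d b m]
    all_goals first | omega | (intros; apply FR_eq <;> simp <;> omega) | skip
    simp only [B, c, hm]
    unfold cR FR RS RD Lh Mh sh
    simp (disch := omega) only [if_pos, if_neg, if_true, if_false, Bool.false_eq_true]
    field_simp [hA]
    ring1
  · rw [tele2 (FR q u v (t * u * v) A a b b) B (c true true true) (c false true true) (c false false false) a b m]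
    all_goals first | omega | (intros; apply FR_eq <;> simp <;> omega) | skip
    simp only [B, c, hm]
    unfold cR FR RS RD Lh Mh sh
    simp (disch := omega) only [if_pos, if_neg, if_true, if_false, Bool.false_eq_true]
    field_simp [hA]
    ring1
  · rw [tele3 (FR q u v (t * u * v) A a b d) B (c true true true) (c true false true) (c false false true) (c false false false) b a d m]
    all_goals first | omega | (intros; apply FR_eq <;> simp <;> omega) | skip
    simp only [B, c, hm]
    unfold cR FR RS RD Lh Mh sh
    simp (disch := omega) only [if_pos, if_neg, if_true, if_false, Bool.false_eq_true]
    field_simp [hA]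
    ring1
  · rw [tele3 (FR q u v (t * u * v) A a b d) B (c true true true) (c true false true) (c true false false) (c false false false) b d a m]
    all_goals first | omega | (intros; apply FR_eq <;> simp <;> omega) | skip
    simp only [B, c, hm]
    unfold cR FR RS RD Lh Mh sh
    simp (disch := omega) only [if_pos, if_neg, if_true, if_false, Bool.false_eq_true]
    field_simp [hA]
    ring1
  · rw [tele2 (FR q u v (t * u * v) A a b a) B (c true true true) (c true false true) (c false false false) b a m]
    all_goals first | omega | (intros; apply FR_eq <;> simp <;> omega) | skip
    simp only [B, c, hm]
    unfold cR FR RS RD Lh Mh sh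
    simp (disch := omega) only [if_pos, if_neg, if_true, if_false, Bool.false_eq_true]
    field_simp [hA]
    ring1
  · rw [tele3 (FR q u v (t * u * v) A a b d) B (c true true true) (c true true false) (c false true false) (c false false false) d a b m]
    all_goals first | omega | (intros; apply FR_eq <;> simp <;> omega) | skip
    simp only [B, c, hm]
    unfold cR FR RS RD Lh Mh sh
    simp (disch := omega) only [if_pos, if_neg, if_true, if_false, Bool.false_eq_true]
    field_simp [hA]
    ring1
  · rw [tele3 (FR q u v (t * u * v) A a b d) B (c true true true) (c true true false) (c true false false) (c false false false) d b a m]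
    all_goals first | omega | (intros; apply FR_eq <;> simp <;> omega) | skip
    simp only [B, c, hm]
    unfold cR FR RS RD Lh Mh sh
    simp (disch := omega) only [if_pos, if_neg, if_true, if_false, Bool.false_eq_true]
    field_simp [hA]
    ring1
  · rw [tele2 (FR q u v (t * u * v) A a b a) B (c true true true) (c false true false) (c false false false) a b m]
    all_goals first | omega | (intros; apply FR_eq <;> simp <;> omega) | skip
    simp only [B, c, hm]
    unfold cR FR RS RD Lh Mh sh
    simp (disch := omega) only [if_pos, if_neg, if_true, if_false, Bool.false_eq_true]
    field_simp [hA]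
    ring1
  · rw [tele2 (FR q u v (t * u * v) A a b b) B (c true true true) (c true false false) (c false false false) b a m]
    all_goals first | omega | (intros; apply FR_eq <;> simp <;> omega) | skip
    simp only [B, c, hm]
    unfold cR FR RS RD Lh Mh sh
    simp (disch := omega) only [if_pos, if_neg, if_true, if_false, Bool.false_eq_true]
    field_simp [hA]
    ring1

set_option maxHeartbeats 8000000 in
theorem case4 (q t u v : ℂ) (hq : q ≠ 0) (ht : t ≠ 0) (hw : t * u * v - 1 ≠ 0)
    (A : ℕ → ℂ) (hA : ∀ k, A k ≠ 0) (m : ℕ) (hm : A m = t * A 0)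
    (a d : ℕ) (ham : a < m) (hdm : d < m) :
    ∑ g ∈ Finset.range m, FL q u v (t * u * v) A a d d g
      = ∑ l ∈ Finset.range m, FR q u v (t * u * v) A a a d l := by
  let B : ℕ → ℂ := fun k => (A k)⁻¹
  let c := cL q u v (t * u * v) A d d
  let c' := cR q u v (t * u * v) A a a
  rcases lt_trichotomy a d with h | rfl | h
  · rw [tele2 (FL q u v (t * u * v) A a d d) B (c true true true) (c false true true)
        (c false false false) a d m,
      tele2 (FR q u v (t * u * v) A a a d) A (c' true true true) (c' false false true)
        (c' false false false) a d m]
    all_goals first | omega | (intros; apply FL_eq <;> simp <;> omega) | (intros; apply FR_eq <;> simp <;> omega) | skip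
    simp only [B, c, c', hm]
    unfold cL cR FL FR RS Lh Mh sh
    simp (disch := omega) only [if_pos, if_neg, if_true, if_false, Bool.false_eq_true]
    field_simp [hA]
    ring1
  · rw [tele1 (FL q u v (t * u * v) A a a a) B (c true true true)
        (c false false false) a m,
      tele1 (FR q u v (t * u * v) A a a a) A (c' true true true)
        (c' false false false) a m]
    all_goals first | omega | (intros; apply FL_eq <;> simp <;> omega) | (intros; apply FR_eq <;> simp <;> omega) | skip
    simp only [B, c, c', hm]
    unfold cL cR FL FR RS Lh Mh sh
    simp (disch := omega) only [if_pos, if_neg, if_true, if_false, Bool.false_eq_true]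
    field_simp [hA]
    ring1
  · rw [tele2 (FL q u v (t * u * v) A a d d) B (c true true true) (c true false false)
        (c false false false) d a m,
      tele2 (FR q u v (t * u * v) A a a d) A (c' true true true) (c' true true false)
        (c' false false false) d a m]
    all_goals first | omega | (intros; apply FL_eq <;> simp <;> omega) | (intros; apply FR_eq <;> simp <;> omega) | skip
    simp only [B, c, c', hm]
    unfold cL cR FL FR RS Lh Mh sh
    simp (disch := omega) only [if_pos, if_neg, if_true, if_false, Bool.false_eq_true]
    field_simp [hA]
    ring1

end YB

namespace YB

/-- sum of the entries `I i` over the colors `i < k` -/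
def lowS (n : ℕ) (I : Vec n) (k : ℕ) : ℕ := ∑ i ∈ Finset.univ.filter (fun i : Col n => i.val < k), I i
/-- sum of the entries `I i` over the colors `i ≥ k` -/
def highS (n : ℕ) (I : Vec n) (k : ℕ) : ℕ := ∑ i ∈ Finset.univ.filter (fun i : Col n => k ≤ i.val), I i

noncomputable def Ac (n : ℕ) (q s : ℂ) (I : Vec n) (k : ℕ) : ℂ :=
  if k ≤ n then q ^ (-(lowS n I k : ℤ)) else s ^ 2 * q ^ (highS n I k : ℤ)

theorem Ac_ne (n : ℕ) (q s : ℂ) (hq : q ≠ 0) (hs : s ≠ 0) (I : Vec n) (k : ℕ) :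
    Ac n q s I k ≠ 0 := by
  unfold Ac
  split_ifs
  · exact zpow_ne_zero _ hq
  · exact mul_ne_zero (pow_ne_zero _ hs) (zpow_ne_zero _ hq)

theorem Ac_top (n : ℕ) (q s : ℂ) (I : Vec n) : Ac n q s I (2*n+1) = s ^ 2 * Ac n q s I 0 := by
  have h1 : highS n I (2*n+1) = 0 := by
    unfold highS
    rw [Finset.filter_false_of_mem]
    · simp
    · intro i _
      have := i.isLt
      omega
  have h2 : lowS n I 0 = 0 := by simp [lowS]
  unfold Ac
  rw [if_neg (by omega), if_pos (by omega), h1, h2]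
  simp

theorem lowS_succ (n : ℕ) (I : Vec n) (l : Col n) : lowS n I (l.val+1) = lowS n I l.val + I l := by
  unfold lowS
  have : Finset.univ.filter (fun i : Col n => i.val < l.val + 1)
      = insert l (Finset.univ.filter (fun i : Col n => i.val < l.val)) := by
    ext i
    simp only [Finset.mem_filter, Finset.mem_univ, true_and, Finset.mem_insert, Fin.ext_iff]
    omega
  rw [this, Finset.sum_insert (by simp)]
  ring

theorem highS_succ (n : ℕ) (I : Vec n) (l : Col n) : highS n I l.val = highS n I (l.val+1) + I l := by
  unfold highS
  have : Finset.univ.filter (fun i : Col n => l.val ≤ i.val)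
      = insert l (Finset.univ.filter (fun i : Col n => l.val + 1 ≤ i.val)) := by
    ext i
    simp only [Finset.mem_filter, Finset.mem_univ, true_and, Finset.mem_insert, Fin.ext_iff]
    omega
  rw [this, Finset.sum_insert (by simp)]
  ring

theorem sLe_eq (n : ℕ) (I : Vec n) (l : Col n) : sLe n I l = lowS n I (l.val+1) := by
  unfold sLe lowS
  congr 1
  ext i
  simp only [Finset.mem_filter, Finset.mem_univ, true_and, Fin.le_def]
  omega

theorem sLt_eq (n : ℕ) (I : Vec n) (l : Col n) : sLt n I l = lowS n I l.val := rfl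
theorem sLo_eq (n : ℕ) (I : Vec n) : sLo n I = lowS n I n := rfl
theorem sGe_eq (n : ℕ) (I : Vec n) (l : Col n) : sGe n I l = highS n I l.val := rfl
theorem sGt_eq (n : ℕ) (I : Vec n) (l : Col n) : sGt n I l = highS n I (l.val+1) := rfl
theorem sHi_eq (n : ℕ) (I : Vec n) : sHi n I = highS n I (n+1) := rfl

theorem lt_mid (n : ℕ) (l : Col n) : l < mid n ↔ l.val < n := Iff.rfl
theorem eq_mid (n : ℕ) (l : Col n) : l = mid n ↔ l.val = n := by
  rw [Fin.ext_iff]; rfl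

theorem LW_eq (n : ℕ) (q s x : ℂ) (hq : q ≠ 0) (hs : s ≠ 0) (hx : 1 - s * x ≠ 0)
    (I : Vec n) (j : Col n) (K : Vec n) (l : Col n)
    (h : ∀ k, I k + eV n j k = K k + eV n l k) :
    LW n q s x I j K l = Lh (x / s) (Ac n q s I) j.val l.val / (1 - s * x) := by
  unfold LW
  rw [if_pos h]
  simp only [lt_mid, eq_mid, sLe_eq, sLo_eq, sHi_eq, sGt_eq]
  unfold Lh Ac
  simp only [Fin.ext_iff, Fin.lt_def]
  rcases lt_trichotomy l.val n with h1 | h1 | h1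
  · have e1 := lowS_succ n I l
    simp (disch := omega) only [if_pos h1, if_pos, if_neg]
    rw [e1]
    push_cast
    simp only [neg_add, zpow_add₀ hq, zpow_neg]
    have := zpow_ne_zero (I l : ℤ) hq
    have := zpow_ne_zero (lowS n I l.val : ℤ) hq
    split_ifs <;> field_simp <;> ring
  · have e1 : l.val + 1 = n + 1 := by omega
    simp (disch := omega) only [if_pos h1, if_pos, if_neg]
    rw [e1, h1]
    split_ifs <;> field_simp
  · have e1 := highS_succ n I l
    simp (disch := omega) only [if_pos, if_neg]
    rw [e1]
    push_cast
    simp only [zpow_add₀ hq]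
    split_ifs <;> field_simp <;> ring

theorem MW_eq (n : ℕ) (q s x : ℂ) (hq : q ≠ 0) (hs : s ≠ 0) (hx : 1 - s * x ≠ 0)
    (I : Vec n) (j : Col n) (K : Vec n) (l : Col n)
    (h : ∀ k, I k + eV n j k = K k + eV n l k) :
    MW n q s x I j K l = s ^ 2 * Mh (x / s) (Ac n q s I) j.val l.val / (1 - s * x) := by
  unfold MW
  rw [if_pos h]
  simp only [lt_mid, eq_mid, sLt_eq, sLo_eq, sHi_eq, sGt_eq, sGe_eq]
  unfold Mh Ac
  simp only [Fin.ext_iff, Fin.lt_def]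
  rcases lt_trichotomy l.val n with h1 | h1 | h1
  · have e1 := lowS_succ n I l
    simp (disch := omega) only [if_pos h1, if_pos, if_neg]
    rw [e1]
    push_cast
    simp only [neg_add, zpow_add₀ hq, zpow_neg]
    have := zpow_ne_zero (I l : ℤ) hq
    have := zpow_ne_zero (lowS n I l.val : ℤ) hq
    split_ifs <;> field_simp <;> ring
  · have e1 : l.val + 1 = n + 1 := by omega
    simp (disch := omega) only [if_pos h1, if_pos, if_neg]
    rw [e1, h1]
    simp only [zpow_neg]
    have := zpow_ne_zero (lowS n I n : ℤ) hq
    have := zpow_ne_zero (highS n I (n+1) : ℤ) hq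
    split_ifs <;> field_simp
  · have e1 := highS_succ n I l
    simp (disch := omega) only [if_pos, if_neg]
    rw [e1]
    push_cast
    simp only [neg_add, zpow_add₀ hq, zpow_neg]
    have := zpow_ne_zero (I l : ℤ) hq
    have := zpow_ne_zero (highS n I (l.val+1) : ℤ) hq
    split_ifs <;> field_simp <;> ring

theorem sum_eV (n : ℕ) (c : Col n) (P : Col n → Prop) [DecidablePred P] :
    ∑ i ∈ Finset.univ.filter P, eV n c i = if c ≠ mid n ∧ P c then 1 else 0 := by
  unfold eV
  by_cases h : c ≠ mid n
  · simp [h, Finset.sum_ite_eq']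
  · simp [h]

theorem Ac_add (n : ℕ) (q s : ℂ) (hq : q ≠ 0) (I : Vec n) (c : Col n) (k : ℕ) :
    Ac n q s (fun i => I i + eV n c i) k
      = Ac n q s I k * (if c.val < k then q⁻¹ else 1) * (if n < k then q else 1) := by
  unfold Ac lowS highS
  simp only [Finset.sum_add_distrib, sum_eV, ne_eq, eq_mid]
  rcases lt_trichotomy c.val n with h | h | h <;> rcases le_or_gt k n with h' | h' <;>
  rcases lt_or_ge c.val k with h'' | h'' <;>
  first
  | omega
  | simp (disch := omega) only [if_pos, if_neg]
    push_cast
    simp only [neg_add, zpow_add₀ hq, zpow_neg, zpow_one, zpow_zero]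
    field_simp

theorem Ac_sh (n : ℕ) (q s : ℂ) (hq : q ≠ 0) (I : Vec n) (j : Col n) (K : Vec n) (l : Col n)
    (h : ∀ k, I k + eV n j k = K k + eV n l k) :
    Ac n q s K = sh q (Ac n q s I) j.val l.val := by
  funext k
  have h1 := Ac_add n q s hq I j k
  have h2 := Ac_add n q s hq K l k
  rw [funext h] at h1
  rw [h1] at h2
  unfold sh
  have h3 : Ac n q s I k * (if j.val < k then q⁻¹ else 1)
      = Ac n q s K k * (if l.val < k then q⁻¹ else 1) := by
    refine mul_right_cancel₀ (b := if n < k then q else 1) ?_ h2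
    split_ifs <;> simp [hq]
  rw [h3]
  split_ifs <;> field_simp

theorem no_target (n : ℕ) (q s : ℂ) (I : Vec n) (j l : Col n)
    (h : ¬ ∃ K : Vec n, ∀ k, I k + eV n j k = K k + eV n l k) :
    j.val ≠ l.val ∧ Ac n q s I (l.val+1) = Ac n q s I l.val := by
  have hjl : j ≠ l := by
    rintro rfl
    exact h ⟨I, fun _ => rfl⟩
  have hlm : l ≠ mid n := by
    rintro rfl
    exact h ⟨fun k => I k + eV n j k, fun k => by simp [eV]⟩
  have hI : I l = 0 := by
    by_contra h0
    refine h ⟨fun k => I k + eV n j k - eV n l k, fun k => ?_⟩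
    have : eV n l k ≤ I k := by
      unfold eV
      split_ifs with h1
      · rw [h1.2]; omega
      · omega
    beta_reduce
    omega
  have hjl' : j.val ≠ l.val := fun h => hjl (Fin.ext h)
  rw [ne_eq, eq_mid] at hlm
  refine ⟨hjl', ?_⟩
  unfold Ac
  have e1 := lowS_succ n I l
  have e2 := highS_succ n I l
  rw [hI, add_zero] at e1 e2
  rw [e1, e2]
  rcases lt_or_ge l.val n with h1 | h1
  · rw [if_pos (by omega), if_pos (by omega)]
  · rw [if_neg (by omega), if_neg (by omega)]

theorem fs (n : ℕ) (I : Vec n) (j l : Col n) (Φ : Vec n → ℂ) (Y : ℂ)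
    (h0 : (¬ ∃ K : Vec n, ∀ k, I k + eV n j k = K k + eV n l k) → Y = 0)
    (h1 : ∀ K : Vec n, (∀ k, I k + eV n j k = K k + eV n l k) → Φ K = Y)
    (h2 : ∀ K : Vec n, (¬ ∀ k, I k + eV n j k = K k + eV n l k) → Φ K = 0) :
    ∑ᶠ K, Φ K = Y := by
  by_cases h : ∃ K : Vec n, ∀ k, I k + eV n j k = K k + eV n l k
  · obtain ⟨K, hK⟩ := h
    rw [finsum_eq_single Φ K, h1 K hK]
    intro K' hne
    apply h2
    intro hK'
    apply hne
    funext k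
    have a1 := hK k
    have a2 := hK' k
    omega
  · rw [h0 h]
    rw [finsum_congr (fun K => h2 K (fun hK => h ⟨K, hK⟩))]
    simp

theorem R_cons (n : ℕ) (q x y : ℂ) (a b g i : Col n) (h : RDG n q x y a b g i ≠ 0) :
    (a = g ∧ b = i) ∨ (a = b ∧ g = i) := by
  unfold RDG at h
  split_ifs at h <;> simp_all

theorem R_diag (n : ℕ) (q x y w : ℂ) (hw : x * y = w) (a g : Col n) :
    RDG n q x y a a g g = RS q w a.val g.val := by
  subst hw
  unfold RDG RS
  rcases lt_trichotomy a g with h | h | h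
  · have h' := Fin.lt_def.1 h
    simp (disch := omega) only [if_neg]
    simp [h, h.ne, h.not_gt, mul_assoc]
  · subst h; simp
  · have h' := Fin.lt_def.1 h
    simp (disch := omega) only [if_neg, if_pos]
    simp [h, h.ne']

theorem R_off (n : ℕ) (q x y w : ℂ) (hw : x * y = w) (a b : Col n) (hab : a ≠ b) :
    RDG n q x y a b a b = RD q w a.val b.val := by
  subst hw
  unfold RDG RD
  rcases lt_trichotomy a b with h | h | h
  · have h' := Fin.lt_def.1 h
    simp [h, h.ne, mul_assoc]
  · exact absurd h hab
  · have h' := Fin.lt_def.1 h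
    simp (disch := omega) only [if_neg]
    simp [h, h.ne', h.not_gt, mul_assoc]

theorem sumL_diag (n : ℕ) (q x y w : ℂ) (hw : x * y = w) (a : Col n) (T : ℕ → ℕ → ℂ) :
    ∑ g : Col n, ∑ i : Col n, RDG n q x y a a g i * T g.val i.val
      = ∑ g ∈ Finset.range (2*n+1), RS q w a.val g * T g g := by
  rw [← Fin.sum_univ_eq_sum_range (fun g => RS q w a.val g * T g g) (2*n+1)]
  refine Finset.sum_congr rfl (fun g _ => ?_)
  rw [Finset.sum_eq_single g, R_diag n q x y w hw]
  · intro i _ hi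
    rw [mul_eq_zero]
    left
    by_contra h
    rcases R_cons n q x y a a g i h with ⟨h1, h2⟩ | ⟨h1, h2⟩
    · exact hi (h2.symm.trans h1)
    · exact hi h2.symm
  · simp

theorem sumL_off (n : ℕ) (q x y w : ℂ) (hw : x * y = w) (a b : Col n) (hab : a ≠ b)
    (T : ℕ → ℕ → ℂ) :
    ∑ g : Col n, ∑ i : Col n, RDG n q x y a b g i * T g.val i.val
      = RD q w a.val b.val * T a.val b.val := by
  have key : ∀ g i : Col n, ¬ (a = g ∧ b = i) → RDG n q x y a b g i * T g.val i.val = 0 := by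
    intro g i h
    rw [mul_eq_zero]
    left
    by_contra h'
    rcases R_cons n q x y a b g i h' with h1 | ⟨h1, h2⟩
    · exact h h1
    · exact hab h1
  rw [Finset.sum_eq_single a, Finset.sum_eq_single b, R_off n q x y w hw a b hab]
  · exact fun i _ hi => key _ _ (fun h => hi h.2.symm)
  · simp
  · exact fun g _ hg => Finset.sum_eq_zero (fun i _ => key _ _ (fun h => hg h.1.symm))
  · simp

theorem sumR_diag (n : ℕ) (q x y w : ℂ) (hw : x * y = w) (d : Col n) (T : ℕ → ℕ → ℂ) :
    ∑ j : Col n, ∑ l : Col n, T l.val j.val * RDG n q x y l j d d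
      = ∑ l ∈ Finset.range (2*n+1), T l l * RS q w l d.val := by
  rw [← Fin.sum_univ_eq_sum_range (fun l => T l l * RS q w l d.val) (2*n+1)]
  refine Finset.sum_congr rfl (fun j _ => ?_)
  rw [Finset.sum_eq_single j, R_diag n q x y w hw]
  · intro i _ hi
    rw [mul_eq_zero]
    right
    by_contra h
    rcases R_cons n q x y i j d d h with ⟨h1, h2⟩ | ⟨h1, h2⟩
    · exact hi (h1.trans h2.symm)
    · exact hi h1
  · simp

theorem sumR_off (n : ℕ) (q x y w : ℂ) (hw : x * y = w) (d e : Col n) (hde : d ≠ e)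
    (T : ℕ → ℕ → ℂ) :
    ∑ j : Col n, ∑ l : Col n, T l.val j.val * RDG n q x y l j d e
      = T d.val e.val * RD q w d.val e.val := by
  have key : ∀ j l : Col n, ¬ (l = d ∧ j = e) → T l.val j.val * RDG n q x y l j d e = 0 := by
    intro j l h
    rw [mul_eq_zero]
    right
    by_contra h'
    rcases R_cons n q x y l j d e h' with h1 | ⟨h1, h2⟩
    · exact h h1
    · exact hde h2
  rw [Finset.sum_eq_single e, Finset.sum_eq_single d, R_off n q x y w hw d e hde]
  · exact fun i _ hi => key _ _ (fun h => hi h.1)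
  · simp
  · exact fun g _ hg => Finset.sum_eq_zero (fun i _ => key _ _ (fun h => hg h.2))
  · simp

theorem core (q t u v : ℂ) (hq : q ≠ 0) (ht : t ≠ 0) (hw : t * u * v - 1 ≠ 0)
    (n : ℕ) (A : ℕ → ℂ) (hA : ∀ k, A k ≠ 0) (hm : A (2*n+1) = t * A 0) (x y : ℂ)
    (hxy : x * y = t * u * v) (a b d e : Col n) :
    ∑ g : Col n, ∑ i : Col n, RDG n q x y a b g i *
        (Lh v (sh q A e.val i.val) g.val d.val * Mh u A e.val i.val)
      = ∑ j : Col n, ∑ l : Col n,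
        (Mh u (sh q A a.val l.val) j.val b.val * Lh v A a.val l.val) * RDG n q x y l j d e := by
  have vne : ∀ {a b : Col n}, a ≠ b → a.val ≠ b.val := fun h h' => h (Fin.ext h')
  by_cases hab : a = b
  · subst hab
    rw [sumL_diag n q x y _ hxy a
      (fun g i => Lh v (sh q A e.val i) g d.val * Mh u A e.val i)]
    by_cases hde : d = e
    · subst hde
      rw [sumR_diag n q x y _ hxy d
        (fun l j => Mh u (sh q A a.val l) j a.val * Lh v A a.val l)]
      have := case4 q t u v hq ht hw A hA (2*n+1) hm a.val d.val a.isLt d.isLt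
      simpa only [FL, FR, mul_assoc] using this
    · rw [sumR_off n q x y _ hxy d e hde
        (fun l j => Mh u (sh q A a.val l) j a.val * Lh v A a.val l)]
      have := case2 q t u v hq ht hw A hA (2*n+1) hm a.val d.val e.val (vne hde)
        a.isLt d.isLt e.isLt
      simpa only [FL, FR, mul_assoc] using this
  · rw [sumL_off n q x y _ hxy a b hab
      (fun g i => Lh v (sh q A e.val i) g d.val * Mh u A e.val i)]
    by_cases hde : d = e
    · subst hde
      rw [sumR_diag n q x y _ hxy d
        (fun l j => Mh u (sh q A a.val l) j b.val * Lh v A a.val l)]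
      have := case3 q t u v hq ht hw A hA (2*n+1) hm a.val b.val d.val (vne hab)
        a.isLt b.isLt d.isLt
      simpa only [FL, FR, mul_assoc] using this.symm
    · rw [sumR_off n q x y _ hxy d e hde
        (fun l j => Mh u (sh q A a.val l) j b.val * Lh v A a.val l)]
      have := case1 q u v (t * u * v) hq hw A hA a.val b.val d.val e.val (vne hab) (vne hde)
      simpa only [mul_assoc] using this

theorem cons_eV (n : ℕ) (q x y : ℂ) (a b g i : Col n) (h : RDG n q x y a b g i ≠ 0) (k : Col n) :
    eV n a k + eV n i k = eV n b k + eV n g k := by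
  rcases R_cons n q x y a b g i h with ⟨rfl, rfl⟩ | ⟨rfl, rfl⟩ <;> omega

end YB

/-- Yang–Baxter equation, Δ–Γ case: the lower row vertex is a
Δ vertex with spectral parameter `x`, the upper row vertex is a Γ vertex with
spectral parameter `y`. -/
theorem yang_baxter_delta_gamma (n : ℕ) (hn : 0 < n) (q s x y : ℂ)
    (hq : q ≠ 0) (hs : s ≠ 0) (hx : 1 - s * x ≠ 0) (hy : 1 - s * y ≠ 0)
    (hR : x * y - 1 ≠ 0)
    (a b d e : Col n) (c f : Vec n) :
    ∑ g : Col n, ∑ i : Col n, ∑ᶠ h : Vec n,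
        RDG n q x y a b g i * wG n q s y g h d c * wD n q s x i f e h
      = ∑ j : Col n, ∑ l : Col n, ∑ᶠ k : Vec n,
        wD n q s x b k j c * wG n q s y a f l k * RDG n q x y l j d e := by
  have LW0 : ∀ (z : ℂ) (I : Vec n) (j : Col n) (K : Vec n) (l : Col n),
      (¬ ∀ k, I k + eV n j k = K k + eV n l k) → LW n q s z I j K l = 0 :=
    fun z I j K l h => by unfold LW; rw [if_neg h]
  have MW0 : ∀ (z : ℂ) (I : Vec n) (j : Col n) (K : Vec n) (l : Col n),
      (¬ ∀ k, I k + eV n j k = K k + eV n l k) → MW n q s z I j K l = 0 :=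
    fun z I j K l h => by unfold MW; rw [if_neg h]
  unfold wG wD
  by_cases C : ∀ k, f k + eV n e k + eV n a k = c k + eV n d k + eV n b k
  · have hxy : x * y = s ^ 2 * (x / s) * (y / s) := by field_simp
    have hcore := YB.core q (s ^ 2) (x / s) (y / s) hq (pow_ne_zero _ hs) (hxy ▸ hR) n
      (YB.Ac n q s f) (YB.Ac_ne n q s hq hs f) (YB.Ac_top n q s f) x y hxy a b d e
    have hL : ∀ g i : Col n, ∑ᶠ h : Vec n,
        RDG n q x y a b g i * LW n q s y h g c d * MW n q s x f e h i
        = RDG n q x y a b g i * (YB.Lh (y / s) (YB.sh q (YB.Ac n q s f) e.val i.val) g.val d.val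
          * YB.Mh (x / s) (YB.Ac n q s f) e.val i.val)
          * (s ^ 2 / ((1 - s * x) * (1 - s * y))) := by
      intro g i
      apply YB.fs n f e i
      · intro h
        obtain ⟨h1, h2⟩ := YB.no_target n q s f e i h
        simp [YB.Mh, h1, h2]
      · intro h hh
        by_cases hr : RDG n q x y a b g i = 0
        · simp [hr]
        · have hc := YB.cons_eV n q x y a b g i hr
          rw [YB.LW_eq n q s y hq hs hy h g c d (fun k => by
              have := C k; have := hc k; have := hh k; omega),
            YB.MW_eq n q s x hq hs hx f e h i hh, YB.Ac_sh n q s hq f e h i hh]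
          field_simp
      · intro h hh
        rw [MW0 _ _ _ _ _ hh, mul_zero]
    have hRr : ∀ j l : Col n, ∑ᶠ k : Vec n,
        MW n q s x k j c b * LW n q s y f a k l * RDG n q x y l j d e
        = (YB.Mh (x / s) (YB.sh q (YB.Ac n q s f) a.val l.val) j.val b.val
          * YB.Lh (y / s) (YB.Ac n q s f) a.val l.val) * RDG n q x y l j d e
          * (s ^ 2 / ((1 - s * x) * (1 - s * y))) := by
      intro j l
      apply YB.fs n f a l
      · intro h
        obtain ⟨h1, h2⟩ := YB.no_target n q s f a l h
        simp [YB.Lh, h1, h2]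
      · intro h hh
        by_cases hr : RDG n q x y l j d e = 0
        · simp [hr]
        · have hc := YB.cons_eV n q x y l j d e hr
          rw [YB.MW_eq n q s x hq hs hx h j c b (fun k => by
              have := C k; have := hc k; have := hh k; omega),
            YB.LW_eq n q s y hq hs hy f a h l hh, YB.Ac_sh n q s hq f a h l hh]
          field_simp
      · intro h hh
        rw [LW0 _ _ _ _ _ hh, mul_zero, zero_mul]
    simp only [hL, hRr, ← Finset.sum_mul]
    rw [hcore]
  · have hL : ∀ g i : Col n, ∀ h : Vec n,
        RDG n q x y a b g i * LW n q s y h g c d * MW n q s x f e h i = 0 := by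
      intro g i h
      by_contra hne
      have hr : RDG n q x y a b g i ≠ 0 := fun h0 => hne (by simp [h0])
      have hc := YB.cons_eV n q x y a b g i hr
      have h1 := not_imp_comm.1 (LW0 y h g c d) (fun h0 => hne (by simp [h0]))
      have h2 := not_imp_comm.1 (MW0 x f e h i) (fun h0 => hne (by simp [h0]))
      exact C (fun k => by have := h1 k; have := h2 k; have := hc k; omega)
    have hRr : ∀ j l : Col n, ∀ k : Vec n,
        MW n q s x k j c b * LW n q s y f a k l * RDG n q x y l j d e = 0 := by
      intro j l h
      by_contra hne
      have hr : RDG n q x y l j d e ≠ 0 := fun h0 => hne (by simp [h0])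
      have hc := YB.cons_eV n q x y l j d e hr
      have h1 := not_imp_comm.1 (MW0 x h j c b) (fun h0 => hne (by simp [h0]))
      have h2 := not_imp_comm.1 (LW0 y f a h l) (fun h0 => hne (by simp [h0]))
      exact C (fun k => by have := h1 k; have := h2 k; have := hc k; omega)
    simp [hL, hRr]
end

section
/- Reflection equation (Proposition 2.2): For all x, y ∈ ℂ (with all denominators nonzero) and all colors ε₁, ε₂, ε₃, ε₄ ∈ {0} ∪ [±n], the following identity holds: Σ over a, b, c, d ∈ {0}∪[±n] of R_{ΔΔ}(ε₂, ε₁, b, a; x, y) · R_{ΔΓ}(ε₃, a, c, d; x, y) · Cap_y(c → b) · Cap_x(ε₄ → d) equals Σ over a', b', c', d' ∈ {0}∪[±n] of R_{ΓΓ}(ε₄, ε₃, a', d'; y, x) · R_{ΔΓ}(a', ε₂, c', b'; y, x) · Cap_x(c' → ε₁) · Cap_y(d' → b'). (This is the equality of the partition functions of the two boundary configurations of Proposition 2.2, with left boundary colors ε₁, ε₂, ε₃, ε₄ from top to bottom: on the left side S is a Δ–Δ vertex with parameters (x,y), T is a Δ–Γ vertex with parameters (x,y), a cap with parameter y joins the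 top two right endpoints and a cap with parameter x joins the bottom two; on the right side S' is a Γ–Γ vertex with parameters (y,x), T' is a Δ–Γ vertex with parameters (y,x), a cap with parameter x joins the top two right endpoints and a cap with parameter y joins the bottom two.) -/
open scoped BigOperators

/-- `φ(z) = (1-z²)/((1-νtz)(1+ν⁻¹z))`. -/
noncomputable def phiF (ν t z : ℂ) : ℂ := (1 - z ^ 2) / ((1 - ν * t * z) * (1 + ν⁻¹ * z))

/-- The cap vertex Boltzmann weight `Cap_x(ε → ε')` (Figure 2.3), where `ε` is
the incoming bottom color and `ε'` the outgoing top color, and `qh` denotes the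
fixed branch of `q^{-1/2}`. -/
noncomputable def capW (n : ℕ) (ν t qh x : ℂ) (ε ε' : Col n) : ℂ :=
  if ε = mid n ∧ ε' = mid n then 1
  else if ε < mid n ∧ ε' = barC n ε then t * phiF ν t (qh * x⁻¹)
  else if ε < mid n ∧ ε' = ε then 1 - t * phiF ν t (qh * x⁻¹)
  else if mid n < ε ∧ ε' = barC n ε then phiF ν t (qh * x⁻¹)
  else if mid n < ε ∧ ε' = ε then 1 - phiF ν t (qh * x⁻¹)
  else 0

/-- The `Δ-Δ` R-weight `R_{ΔΔ}(α,β,γ,δ; x,y)` (Figure 2.6); positions: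
`α` bottom-left, `β` top-left, `γ` top-right, `δ` bottom-right. -/
noncomputable def RDD (n : ℕ) (q x y : ℂ) (α β γ δ : Col n) : ℂ :=
  if α = β ∧ β = γ ∧ γ = δ then 1
  else if α = γ ∧ β = δ ∧ α < β then (y - x) / (y - q * x)
  else if α = γ ∧ β = δ ∧ β < α then q * (y - x) / (y - q * x)
  else if α = δ ∧ β = γ ∧ β < α then (1 - q) * x / (y - q * x)
  else if α = δ ∧ β = γ ∧ α < β then (1 - q) * y / (y - q * x)
  else 0

namespace ReflEq

/-- Diagonal part of a cap weight on integer colors. -/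
def kd (t p : ℂ) (e : ℤ) : ℂ := if e < 0 then 1 - t * p else if 0 < e then 1 - p else 1
/-- Bar-flipping part of a cap weight on integer colors. -/
def kx (t p : ℂ) (e : ℤ) : ℂ := if e < 0 then t * p else if 0 < e then p else 0
/-- Cap weight on integer colors. -/
def cap (t p : ℂ) (e f : ℤ) : ℂ :=
  (if f = e then kd t p e else 0) + (if f = -e then kx t p e else 0)
/-- Color-preserving part of an R-weight. -/
def rd (N A B : ℂ) (a b : ℤ) : ℂ := if a = b then N else if a < b then A else B
/-- Color-exchanging part of an R-weight. -/
def rx (C D : ℂ) (a b : ℤ) : ℂ := if a = b then 0 else if b < a then C else D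

/-- The Delta-Gamma vertex with its two caps, after elimination of the inner sums. -/
def HH (N A B C D t p₁ p₂ : ℂ) (a b o i : ℤ) : ℂ :=
  rd N A B a b * cap t p₁ a o * cap t p₂ i b
  + (if a = b then kd t p₂ i * rx C D a i * cap t p₁ i o
      + kx t p₂ i * rx C D a (-i) * cap t p₁ (-i) o else 0)

lemma cap_zero {t p : ℂ} {e f : ℤ} (h : ¬ |f| = |e|) : cap t p e f = 0 := by
  have h1 : f ≠ e := by rintro rfl; exact h rfl
  have h2 : f ≠ -e := by rintro rfl; exact h (abs_neg e)
  simp [cap, h1, h2]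

lemma HH_zero {N A B C D t p₁ p₂ : ℂ} {a b o i : ℤ}
    (h1 : ¬ (|a| = |o| ∧ |b| = |i|)) (h2 : ¬ (a = b ∧ |o| = |i|)) :
    HH N A B C D t p₁ p₂ a b o i = 0 := by
  unfold HH
  have e1 : rd N A B a b * cap t p₁ a o * cap t p₂ i b = 0 := by
    by_cases h : |o| = |a|
    · rw [cap_zero (e := i) (f := b) (fun h' => h1 ⟨h.symm, h'⟩), mul_zero]
    · rw [cap_zero (e := a) (f := o) h, mul_zero, zero_mul]
  rw [e1, zero_add]
  split_ifs with hab
  · rw [cap_zero (e := i) (f := o) (fun h' => h2 ⟨hab, h'⟩),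
      cap_zero (e := -i) (f := o) (fun h' => h2 ⟨hab, by rw [h', abs_neg]⟩)]
    simp
  · rfl

/-- Left side minus right side, denominators cleared. -/
def TT (q X Y t p w : ℂ) (e1 e2 e3 e4 : ℤ) : ℂ :=
  (rd (X - q * Y) (X - Y) (q * (X - Y)) e2 e1 *
      HH (1 - q * X * Y) (q * (1 - X * Y)) (1 - X * Y) ((1 - q) * X * Y) (1 - q) t w p e3 e1 e2 e4
    + rx ((1 - q) * Y) ((1 - q) * X) e2 e1 *
      HH (1 - q * X * Y) (q * (1 - X * Y)) (1 - X * Y) ((1 - q) * X * Y) (1 - q) t w p e3 e2 e1 e4)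
  - (rd (X - q * Y) (X - Y) (q * (X - Y)) e4 e3 *
      HH (1 - q * X * Y) (q * (1 - X * Y)) (1 - X * Y) ((1 - q) * X * Y) (1 - q) t p w e4 e2 e1 e3
    + rx ((1 - q) * X) ((1 - q) * Y) e4 e3 *
      HH (1 - q * X * Y) (q * (1 - X * Y)) (1 - X * Y) ((1 - q) * X * Y) (1 - q) t p w e3 e2 e1 e4)

/-- Order preserving odd map sending `0, 1, 2` to `0, r, s`. -/
def ff (r s k : ℤ) : ℤ :=
  if k = 0 then 0 else if k = 1 then r else if k = -1 then -r else
    if 0 < k then s + (k - 2) else -s + (k + 2)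

lemma ff_mono {r s : ℤ} (hr : 0 < r) (hs : r < s) : StrictMono (ff r s) := by
  intro a b hab
  unfold ff
  split_ifs <;> omega

lemma ff_neg (r s k : ℤ) : -ff r s k = ff r s (-k) := by
  unfold ff
  split_ifs <;> omega

lemma ff_zero (r s : ℤ) : ff r s 0 = 0 := by simp [ff]

lemma TT_ff {r s : ℤ} (hr : 0 < r) (hs : r < s) (q X Y t p w : ℂ) (e1 e2 e3 e4 : ℤ) :
    TT q X Y t p w (ff r s e1) (ff r s e2) (ff r s e3) (ff r s e4) = TT q X Y t p w e1 e2 e3 e4 := by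
  have hm := ff_mono hr hs
  have h1 : ∀ k, ff r s k < 0 ↔ k < 0 := fun k => by
    conv_lhs => rw [← ff_zero r s]
    exact hm.lt_iff_lt
  have h2 : ∀ k, 0 < ff r s k ↔ 0 < k := fun k => by
    conv_lhs => rw [← ff_zero r s]
    exact hm.lt_iff_lt
  simp only [TT, HH, rd, rx, cap, kd, kx, ff_neg, hm.lt_iff_lt, hm.injective.eq_iff, h1, h2]

set_option maxHeartbeats 4000000 in
lemma TT_small (q X Y t p w : ℂ)
    (rel : Y * w * ((1 - X ^ 2) - p * (1 - t * X ^ 2)) - X * p * ((1 - Y ^ 2) - w * (1 - t * Y ^ 2)) = 0)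
    (e1 e2 e3 e4 : ℤ) (h1 : e1 ∈ Set.Icc (-2) 2) (h2 : e2 ∈ Set.Icc (-2) 2)
    (h : ((e3 = e1 ∨ e3 = -e1) ∧ (e4 = e2 ∨ e4 = -e2)) ∨
      ((e3 = e2 ∨ e3 = -e2) ∧ (e4 = e1 ∨ e4 = -e1))) :
    TT q X Y t p w e1 e2 e3 e4 = 0 := by
  obtain ⟨a1, b1⟩ := h1
  obtain ⟨a2, b2⟩ := h2
  interval_cases e1 <;> interval_cases e2 <;>
  rcases h with ⟨rfl | rfl, rfl | rfl⟩ | ⟨rfl | rfl, rfl | rfl⟩ <;>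
  norm_num [TT, HH, rd, rx, cap, kd, kx] <;>
  first
  | ring1
  | linear_combination (1 - q) * rel
  | linear_combination -(1 - q) * rel
  | linear_combination (1 - q) * q * rel
  | linear_combination -(1 - q) * q * rel
  | linear_combination (1 - q) * t * rel
  | linear_combination -(1 - q) * t * rel
  | linear_combination (1 - q) * q * t * rel
  | linear_combination -(1 - q) * q * t * rel
  | linear_combination (1 - q) ^ 2 * rel
  | linear_combination -(1 - q) ^ 2 * t * rel
  | linear_combination (1 - q) * (t - 1) * rel
  | linear_combination -(1 - q) * q * (t - 1) * rel

lemma exists_ff (a b : ℤ) : ∃ r s k1 k2 : ℤ, 0 < r ∧ r < s ∧ k1 ∈ Set.Icc (-2) 2 ∧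
    k2 ∈ Set.Icc (-2) 2 ∧ a = ff r s k1 ∧ b = ff r s k2 := by
  have key : ∀ r s c : ℤ, (c = 0 ∨ c = r ∨ c = -r ∨ c = s ∨ c = -s) →
      ∃ k ∈ Set.Icc (-2 : ℤ) 2, c = ff r s k := by
    intro r s c hc
    rcases hc with h | h | h | h | h
    · exact ⟨0, by norm_num, by simp [ff, h]⟩
    · exact ⟨1, by norm_num, by simp [ff, h]⟩
    · exact ⟨-1, by norm_num, by simp [ff, h]⟩
    · exact ⟨2, by norm_num, by simp [ff, h]⟩
    · exact ⟨-2, by norm_num, by simp [ff, h]⟩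
  suffices h : ∃ r s : ℤ, 0 < r ∧ r < s ∧ (a = 0 ∨ a = r ∨ a = -r ∨ a = s ∨ a = -s) ∧
      (b = 0 ∨ b = r ∨ b = -r ∨ b = s ∨ b = -s) by
    obtain ⟨r, s, hr, hs, ha, hb⟩ := h
    obtain ⟨k1, hk1, e1⟩ := key r s a ha
    obtain ⟨k2, hk2, e2⟩ := key r s b hb
    exact ⟨r, s, k1, k2, hr, hs, hk1, hk2, e1, e2⟩
  have ca := abs_cases a
  have cb := abs_cases b
  rcases eq_or_ne a 0 with ha | ha
  · rcases eq_or_ne b 0 with hb | hb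
    · exact ⟨1, 2, by omega, by omega, by omega, by omega⟩
    · exact ⟨|b|, |b| + 1, by omega, by omega, by omega, by omega⟩
  · rcases eq_or_ne b 0 with hb | hb
    · exact ⟨|a|, |a| + 1, by omega, by omega, by omega, by omega⟩
    · rcases lt_trichotomy |a| |b| with h | h | h
      · exact ⟨|a|, |b|, by omega, by omega, by omega, by omega⟩
      · exact ⟨|a|, |a| + 1, by omega, by omega, by omega, by omega⟩
      · exact ⟨|b|, |a|, by omega, by omega, by omega, by omega⟩

lemma TT_zero (q X Y t p w : ℂ)
    (rel : Y * w * ((1 - X ^ 2) - p * (1 - t * X ^ 2)) - X * p * ((1 - Y ^ 2) - w * (1 - t * Y ^ 2)) = 0)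
    (e1 e2 e3 e4 : ℤ) : TT q X Y t p w e1 e2 e3 e4 = 0 := by
  by_cases M : (|e3| = |e1| ∧ |e4| = |e2|) ∨ (|e3| = |e2| ∧ |e4| = |e1|)
  · obtain ⟨r, s, k1, k2, hr, hs, hk1, hk2, rfl, rfl⟩ := exists_ff e1 e2
    simp only [abs_eq_abs, ff_neg] at M
    rcases M with ⟨rfl | rfl, rfl | rfl⟩ | ⟨rfl | rfl, rfl | rfl⟩ <;>
    · rw [TT_ff hr hs]
      exact TT_small q X Y t p w rel _ _ _ _ hk1 hk2 (by simp)
  · unfold TT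
    rw [HH_zero, HH_zero, HH_zero, HH_zero]
    · simp
    all_goals
      rintro ⟨h1, h2⟩
      apply M
      try subst h1
      simp_all

/-- Integer value of a color. -/
def vv {n : ℕ} (c : Col n) : ℤ := (c.val : ℤ) - n

lemma vv_inj {n : ℕ} {a b : Col n} : vv a = vv b ↔ a = b := by
  unfold vv; rw [Fin.ext_iff]; omega

lemma vv_lt {n : ℕ} {a b : Col n} : vv a < vv b ↔ a < b := by
  unfold vv; rw [Fin.lt_def]; omega

lemma vv_bar {n : ℕ} (a : Col n) : vv (barC n a) = - vv a := by
  unfold vv barC; have := a.isLt; simp only; omega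

lemma vv_mid (n : ℕ) : vv (mid n) = 0 := by simp [vv, mid]

lemma capW_eq (n : ℕ) (ν t qh x : ℂ) (c d : Col n) :
    capW n ν t qh x c d = (if d = c then kd t (phiF ν t (qh * x⁻¹)) (vv c) else 0)
      + (if d = barC n c then kx t (phiF ν t (qh * x⁻¹)) (vv c) else 0) := by
  unfold capW kd kx
  simp only [← vv_inj, ← vv_lt, vv_bar, vv_mid]
  generalize vv c = a
  generalize vv d = b
  rcases lt_trichotomy a 0 with h | h | h
  · have h1 : ¬ a = 0 := by omega
    have h2 : ¬ 0 < a := by omega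
    by_cases h3 : b = a
    · have h4 : ¬ a = -a := by omega
      simp [h, h1, h2, h3, h4]
    · simp [h, h1, h2, h3]
  · subst h; simp
  · have h1 : ¬ a = 0 := by omega
    have h2 : ¬ a < 0 := by omega
    by_cases h3 : b = a
    · have h4 : ¬ a = -a := by omega
      simp [h, h1, h2, h3, h4]
    · simp [h, h1, h2, h3]

lemma capW_eq' (n : ℕ) (ν t qh x : ℂ) (c d : Col n) :
    capW n ν t qh x c d = cap t (phiF ν t (qh * x⁻¹)) (vv c) (vv d) := by
  rw [capW_eq, cap]
  simp only [← vv_inj, vv_bar]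

lemma R_eq {n : ℕ} (A B C D : ℂ) (α β γ δ : Col n) :
  (if α = β ∧ β = γ ∧ γ = δ then (1 : ℂ)
  else if α = γ ∧ β = δ ∧ α < β then A
  else if α = γ ∧ β = δ ∧ β < α then B
  else if α = δ ∧ β = γ ∧ β < α then C
  else if α = δ ∧ β = γ ∧ α < β then D
  else 0) = (if γ = α ∧ δ = β then rd 1 A B (vv α) (vv β) else 0)
    + (if γ = β ∧ δ = α then rx C D (vv α) (vv β) else 0) := by
  unfold rd rx
  simp only [← vv_inj, ← vv_lt]
  generalize vv α = a
  generalize vv β = b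
  generalize vv γ = c
  generalize vv δ = d
  split_ifs <;> first | omega | simp

lemma RDG_eq {n : ℕ} (A B C D : ℂ) (α β γ δ : Col n) :
  (if α = β ∧ β = γ ∧ γ = δ then (1 : ℂ)
  else if α = γ ∧ β = δ ∧ α < β then A
  else if α = γ ∧ β = δ ∧ β < α then B
  else if α = β ∧ γ = δ ∧ γ < α then C
  else if α = β ∧ γ = δ ∧ α < γ then D
  else 0) = (if γ = α ∧ δ = β then rd 1 A B (vv α) (vv β) else 0)
    + (if α = β ∧ δ = γ then rx C D (vv α) (vv γ) else 0) := by
  unfold rd rx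
  simp only [← vv_inj, ← vv_lt]
  generalize vv α = a
  generalize vv β = b
  generalize vv γ = c
  generalize vv δ = d
  split_ifs <;> first | omega | simp

lemma sum_R {n : ℕ} (u v : ℂ) (α β : Col n) (F : Col n → Col n → ℂ) :
    ∑ c, ∑ d, ((if c = α ∧ d = β then u else 0) + (if c = β ∧ d = α then v else 0)) * F c d
      = u * F α β + v * F β α := by
  simp [add_mul, Finset.sum_add_distrib, ite_and, ite_mul, Finset.sum_ite_irrel]

lemma sum_DG (n : ℕ) (A B C D ν t qh x y : ℂ) (α β o i : Col n) :
    ∑ c, ∑ d, ((if c = α ∧ d = β then rd 1 A B (vv α) (vv β) else 0)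
      + (if α = β ∧ d = c then rx C D (vv α) (vv c) else 0))
        * (capW n ν t qh x c o * capW n ν t qh y i d)
      = HH 1 A B C D t (phiF ν t (qh * x⁻¹)) (phiF ν t (qh * y⁻¹)) (vv α) (vv β) (vv o) (vv i) := by
  have e1 : ∑ c, ∑ d, (if c = α ∧ d = β then rd 1 A B (vv α) (vv β) else 0)
        * (capW n ν t qh x c o * capW n ν t qh y i d)
      = rd 1 A B (vv α) (vv β) * (capW n ν t qh x α o * capW n ν t qh y i β) := by
    simp [ite_and, ite_mul, Finset.sum_ite_irrel]
  have e2 : ∑ c, ∑ d, (if α = β ∧ d = c then rx C D (vv α) (vv c) else 0)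
        * (capW n ν t qh x c o * capW n ν t qh y i d)
      = if α = β then ∑ c, rx C D (vv α) (vv c) * (capW n ν t qh x c o * capW n ν t qh y i c)
        else 0 := by
    by_cases h : α = β <;> simp [h]
  have e3 : ∑ c, rx C D (vv α) (vv c) * (capW n ν t qh x c o * capW n ν t qh y i c)
      = rx C D (vv α) (vv i) * (capW n ν t qh x i o * kd t (phiF ν t (qh * y⁻¹)) (vv i))
        + rx C D (vv α) (-vv i) * (capW n ν t qh x (barC n i) o
          * kx t (phiF ν t (qh * y⁻¹)) (vv i)) := by
    simp only [capW_eq n ν t qh y i, mul_add, Finset.sum_add_distrib, mul_ite, mul_zero,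
      Finset.sum_ite_eq', Finset.sum_ite_eq, Finset.mem_univ, if_true, vv_bar]
  simp only [add_mul, Finset.sum_add_distrib]
  rw [e1, e2, e3, HH]
  simp only [capW_eq', vv_bar, vv_inj]
  congr 1
  · ring
  · split_ifs
    · ring
    · rfl

lemma rd_scale {N A B : ℂ} (hN : N ≠ 0) (a b : ℤ) :
    rd 1 (A / N) (B / N) a b = rd N A B a b / N := by
  unfold rd; split_ifs <;> simp [hN]

lemma rx_scale {N C D : ℂ} (a b : ℤ) :
    rx (C / N) (D / N) a b = rx C D a b / N := by
  unfold rx; split_ifs <;> simp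

lemma HH_scale {N A B C D t p₁ p₂ : ℂ} (hN : N ≠ 0) (a b o i : ℤ) :
    HH 1 (A / N) (B / N) (C / N) (D / N) t p₁ p₂ a b o i = HH N A B C D t p₁ p₂ a b o i / N := by
  unfold HH
  rw [rd_scale hN, rx_scale, rx_scale]
  split_ifs <;> ring

lemma phi_rel (ν t X Y : ℂ) (hν : ν ≠ 0)
    (hcx1 : 1 - ν * t * X ≠ 0) (hcx2 : 1 + ν⁻¹ * X ≠ 0)
    (hcy1 : 1 - ν * t * Y ≠ 0) (hcy2 : 1 + ν⁻¹ * Y ≠ 0) :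
    Y * phiF ν t Y * ((1 - X ^ 2) - phiF ν t X * (1 - t * X ^ 2))
      - X * phiF ν t X * ((1 - Y ^ 2) - phiF ν t Y * (1 - t * Y ^ 2)) = 0 := by
  have key : ∀ Z : ℂ, 1 - ν * t * Z ≠ 0 → 1 + ν⁻¹ * Z ≠ 0 →
      (1 - Z ^ 2) - phiF ν t Z * (1 - t * Z ^ 2) = phiF ν t Z * ((ν⁻¹ - ν * t) * Z) := by
    intro Z h1 h2
    have h : phiF ν t Z * ((1 - ν * t * Z) * (1 + ν⁻¹ * Z)) = 1 - Z ^ 2 :=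
      div_mul_cancel₀ _ (mul_ne_zero h1 h2)
    have h3 : ν * ν⁻¹ = 1 := mul_inv_cancel₀ hν
    linear_combination -h - phiF ν t Z * t * Z ^ 2 * h3
  rw [key X hcx1 hcx2, key Y hcy1 hcy2]
  ring

end ReflEq

/-- the reflection equation, Proposition 2.2. -/
theorem reflection_equation (n : ℕ) (hn : 0 < n) (q ν t qh x y : ℂ)
    (hq : q ≠ 0) (hqh : qh ^ 2 * q = 1) (hν : ν ≠ 0)
    (hx0 : x ≠ 0) (hy0 : y ≠ 0)
    (hRGG : y - q * x ≠ 0) (hRDG : x * y - 1 ≠ 0)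
    (hcx1 : 1 - ν * t * (qh * x⁻¹) ≠ 0) (hcx2 : 1 + ν⁻¹ * (qh * x⁻¹) ≠ 0)
    (hcy1 : 1 - ν * t * (qh * y⁻¹) ≠ 0) (hcy2 : 1 + ν⁻¹ * (qh * y⁻¹) ≠ 0)
    (ε₁ ε₂ ε₃ ε₄ : Col n) :
    ∑ a : Col n, ∑ b : Col n, ∑ c : Col n, ∑ d : Col n,
        RDD n q x y ε₂ ε₁ b a * RDG n q x y ε₃ a c d
          * capW n ν t qh y c b * capW n ν t qh x ε₄ d
      = ∑ a' : Col n, ∑ b' : Col n, ∑ c' : Col n, ∑ d' : Col n,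
        RGG n q y x ε₄ ε₃ a' d' * RDG n q y x a' ε₂ c' b'
          * capW n ν t qh x c' ε₁ * capW n ν t qh y d' b' := by
  have hqh0 : qh ≠ 0 := by rintro rfl; simp at hqh
  have hq' : q = (qh ^ 2)⁻¹ := by
    field_simp; linear_combination hqh
  set X := qh * x⁻¹ with hX
  set Y := qh * y⁻¹ with hY
  set p := phiF ν t X with hp
  set w := phiF ν t Y with hw
  have eN : X - q * Y = qh * (y - q * x) / (x * y) := by
    rw [hX, hY]; field_simp
  have eG : 1 - q * X * Y = (x * y - 1) / (x * y) := by
    rw [hX, hY, hq']; field_simp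
  have hN : X - q * Y ≠ 0 := by
    rw [eN]; exact div_ne_zero (mul_ne_zero hqh0 hRGG) (mul_ne_zero hx0 hy0)
  have hG : 1 - q * X * Y ≠ 0 := by
    rw [eG]; exact div_ne_zero hRDG (mul_ne_zero hx0 hy0)
  have hxy : x * y ≠ 0 := mul_ne_zero hx0 hy0
  -- the weights in the variables `X`, `Y`
  have s1 : (y - x) / (y - q * x) = (X - Y) / (X - q * Y) := by
    rw [div_eq_div_iff hRGG hN, hX, hY]; field_simp
  have s2 : q * (y - x) / (y - q * x) = q * (X - Y) / (X - q * Y) := by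
    rw [mul_div_assoc, s1, mul_div_assoc]
  have s3 : (1 - q) * x / (y - q * x) = (1 - q) * Y / (X - q * Y) := by
    rw [div_eq_div_iff hRGG hN, hX, hY]; field_simp
  have s4 : (1 - q) * y / (y - q * x) = (1 - q) * X / (X - q * Y) := by
    rw [div_eq_div_iff hRGG hN, hX, hY]; field_simp
  have hXY : q * X * Y * (x * y) = 1 := by
    rw [hX, hY, hq']; field_simp
  have g1 : (q * x * y - 1) / (x * y - 1) = q * (1 - X * Y) / (1 - q * X * Y) := by
    rw [div_eq_div_iff hRDG hG]
    linear_combination (1 - q) * hXY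
  have g2 : (q * x * y - 1) / (q * (x * y - 1)) = (1 - X * Y) / (1 - q * X * Y) := by
    rw [div_eq_div_iff (mul_ne_zero hq hRDG) hG]
    linear_combination (1 - q) * hXY
  have g3 : (1 - q) / (q * (x * y - 1)) = (1 - q) * X * Y / (1 - q * X * Y) := by
    rw [div_eq_div_iff (mul_ne_zero hq hRDG) hG]
    linear_combination -(1 - q) * hXY
  have g4 : (1 - q) * x * y / (x * y - 1) = (1 - q) / (1 - q * X * Y) := by
    rw [div_eq_div_iff hRDG hG]
    linear_combination -(1 - q) * hXY
  have dd : ∀ α β γ δ : Col n, RDD n q x y α β γ δ =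
      (if γ = α ∧ δ = β then ReflEq.rd (X - q * Y) (X - Y) (q * (X - Y)) (ReflEq.vv α)
        (ReflEq.vv β) / (X - q * Y) else 0)
      + (if γ = β ∧ δ = α then ReflEq.rx ((1 - q) * Y) ((1 - q) * X) (ReflEq.vv α)
        (ReflEq.vv β) / (X - q * Y) else 0) := by
    intro α β γ δ
    rw [RDD, ReflEq.R_eq, s1, s2, s3, s4, ReflEq.rd_scale hN, ReflEq.rx_scale]
  have gg : ∀ α β γ δ : Col n, RGG n q y x α β γ δ =
      (if γ = α ∧ δ = β then ReflEq.rd (X - q * Y) (X - Y) (q * (X - Y)) (ReflEq.vv α)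
        (ReflEq.vv β) / (X - q * Y) else 0)
      + (if γ = β ∧ δ = α then ReflEq.rx ((1 - q) * X) ((1 - q) * Y) (ReflEq.vv α)
        (ReflEq.vv β) / (X - q * Y) else 0) := by
    intro α β γ δ
    rw [RGG, ReflEq.R_eq, s1, s2, s3, s4, ReflEq.rd_scale hN, ReflEq.rx_scale]
  have sym : ∀ α β γ δ : Col n, RDG n q y x α β γ δ = RDG n q x y α β γ δ := by
    intro α β γ δ
    unfold RDG
    rw [mul_right_comm q y x, mul_comm y x, mul_right_comm (1 - q) y x]
  have dg : ∀ (x' y' : ℂ) (α β o i : Col n),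
      ∑ c, ∑ d, RDG n q x y α β c d * (capW n ν t qh x' c o * capW n ν t qh y' i d)
      = ReflEq.HH (1 - q * X * Y) (q * (1 - X * Y)) (1 - X * Y) ((1 - q) * X * Y) (1 - q) t
          (phiF ν t (qh * x'⁻¹)) (phiF ν t (qh * y'⁻¹)) (ReflEq.vv α) (ReflEq.vv β)
          (ReflEq.vv o) (ReflEq.vv i) / (1 - q * X * Y) := by
    intro x' y' α β o i
    rw [← ReflEq.HH_scale hG, ← ReflEq.sum_DG]
    refine Finset.sum_congr rfl fun c _ => Finset.sum_congr rfl fun d _ => ?_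
    rw [RDG, ReflEq.RDG_eq, g1, g2, g3, g4]
  have lhs : ∑ a : Col n, ∑ b : Col n, ∑ c : Col n, ∑ d : Col n,
        RDD n q x y ε₂ ε₁ b a * RDG n q x y ε₃ a c d
          * capW n ν t qh y c b * capW n ν t qh x ε₄ d
      = ∑ b : Col n, ∑ a : Col n, RDD n q x y ε₂ ε₁ b a *
        ∑ c, ∑ d, RDG n q x y ε₃ a c d * (capW n ν t qh y c b * capW n ν t qh x ε₄ d) := by
    rw [Finset.sum_comm]
    simp only [Finset.mul_sum, mul_assoc]
  have rhs : ∑ a' : Col n, ∑ b' : Col n, ∑ c' : Col n, ∑ d' : Col n,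
        RGG n q y x ε₄ ε₃ a' d' * RDG n q y x a' ε₂ c' b'
          * capW n ν t qh x c' ε₁ * capW n ν t qh y d' b'
      = ∑ a' : Col n, ∑ d' : Col n, RGG n q y x ε₄ ε₃ a' d' *
        ∑ c', ∑ b', RDG n q x y a' ε₂ c' b' *
          (capW n ν t qh x c' ε₁ * capW n ν t qh y d' b') := by
    simp only [Finset.mul_sum, mul_assoc, sym]
    refine Finset.sum_congr rfl fun a' _ => ?_
    calc _ = ∑ b', ∑ d', ∑ c', _ := Finset.sum_congr rfl fun b' _ => Finset.sum_comm
      _ = ∑ d', ∑ b', ∑ c', _ := Finset.sum_comm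
      _ = _ := Finset.sum_congr rfl fun d' _ => Finset.sum_comm
  rw [lhs, rhs]
  simp only [dg, dd, gg]
  rw [ReflEq.sum_R, ReflEq.sum_R]
  have rel := ReflEq.phi_rel ν t X Y hν hcx1 hcx2 hcy1 hcy2
  have fin := ReflEq.TT_zero q X Y t p w rel (ReflEq.vv ε₁) (ReflEq.vv ε₂) (ReflEq.vv ε₃)
    (ReflEq.vv ε₄)
  unfold ReflEq.TT at fin
  rw [← hX, ← hY, ← hp, ← hw]
  linear_combination fin * (X - q * Y)⁻¹ * (1 - q * X * Y)⁻¹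
end

section
/- Theorem 3.1 (evaluation of the partition function for special boundary conditions): Assume σ = Id (the identity signed permutation), every μ_i is negative (μ_i ∈ {−L,…,−1}), and |μ_1| ≥ |μ_2| ≥ ⋯ ≥ |μ_n|. For each j ∈ {1,…,L} let m_j(μ) := #{i ∈ [n] : μ_i = −j}, and for α ∈ ℂ let (α; q^{−1})_m := (1−α)(1−q^{−1}α)⋯(1−q^{−(m−1)}α) with (α; q^{−1})_0 := 1. Then f_μ^σ(x) = t^n · Π_{i=1}^n φ(q^{−1/2} x_i^{−1}) · Π_{i=1}^n ((s−x_i)/(s(1−s x_i)))^{L−μ_i−1} · Π_{i=1}^n (−s x_i/(1−s x_i)) · Π_{j=1}^L (s^{−2}; q^{−1})_{m_j(μ)}. (Note L − μ_i − 1 = L + |μ_i| − 1 since μ_i < 0.) -/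
open scoped BigOperators

/-- A state of the model on the `2n × L` lattice: the first component assigns a
color to each horizontal edge (row `r : Fin (2n)`, 0-indexed top to bottom, and
horizontal position `p : Fin (L+1)`, with `p = 0` the right boundary and
`p = L` the left boundary; the vertex in the paper's column `c+1` of row `r+1`
lies between positions `c` (east) and `c+1` (west)); the second component
assigns a vector in `ℕ^{2n}` to each vertical edge (level `v : Fin (2n+1)`,
with `v = 0` the top boundary and `v = 2n` the bottom boundary, and column
`c : Fin L`, 0-indexed right to left). -/
abbrev St (n L : ℕ) := (Fin (2*n) × Fin (L+1) → Col n) × (Fin (2*n+1) × Fin L → Vec n)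

/-- The vector assigned at the top of column `c` (the paper's column `c+1`):
`∑_{i=1}^n (1_{μ_i = c+1} e_i + 1_{μ_i = -(c+1)} e_{ī})`. -/
def topV (n L : ℕ) (μ : Fin n → ℤ) (c : Fin L) : Vec n := fun k =>
  ∑ i : Fin n,
    ((if μ i = (c.val : ℤ) + 1 ∧ k = posC n i then 1 else 0) +
     (if μ i = -((c.val : ℤ) + 1) ∧ k = barC n (posC n i) then 1 else 0))

/-- The boundary conditions of the model with data `(σ, μ)`: on the left, the
paper's row `2i-1` (a Δ row, 0-indexed row `2i-2`, even) carries the color `0`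
and the paper's row `2i` (a Γ row, 0-indexed row `2i-1`, odd) carries the color
`σ(i)`; at the bottom every vertical edge carries the zero vector; at the top
the vertical edge in column `c` carries `topV μ c`. -/
def BC (n L : ℕ) (σ : Equiv.Perm (Col n)) (μ : Fin n → ℤ) (st : St n L) : Prop :=
  (∀ r : Fin (2*n), st.1 (r, Fin.last L) =
      if r.val % 2 = 0 then mid n
      else σ (posC n ⟨r.val / 2, by have := r.isLt; omega⟩)) ∧
  (∀ c : Fin L, st.2 (0, c) = topV n L μ c) ∧
  (∀ c : Fin L, st.2 (Fin.last (2*n), c) = fun _ => 0)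

/-- The Boltzmann weight of a state: the product of the weights of all the
Γ, Δ and cap vertices.  Even 0-indexed rows (the paper's odd rows `2i-1`) are
rows of Δ vertices and odd 0-indexed rows (the paper's even rows `2i`) are rows
of Γ vertices, both with spectral parameter `x i`; the cap with spectral
parameter `x i` joins the right end of the paper's row `2i` (incoming, bottom)
to the right end of the paper's row `2i-1` (outgoing, top).
Here `qh` denotes the fixed branch of `q^{-1/2}`. -/
noncomputable def stWt (n L : ℕ) (q s ν t qh : ℂ) (x : Fin n → ℂ) (st : St n L) : ℂ :=
  (∏ r : Fin (2*n), ∏ c : Fin L,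
    if r.val % 2 = 0 then
      MW n q s (x ⟨r.val / 2, by have := r.isLt; omega⟩)
        (st.2 (r.succ, c)) (st.1 (r, c.castSucc)) (st.2 (r.castSucc, c)) (st.1 (r, c.succ))
    else
      LW n q s (x ⟨r.val / 2, by have := r.isLt; omega⟩)
        (st.2 (r.succ, c)) (st.1 (r, c.succ)) (st.2 (r.castSucc, c)) (st.1 (r, c.castSucc)))
  * ∏ i : Fin n,
      capW n ν t qh (x i)
        (st.1 (⟨2 * i.val + 1, by have := i.isLt; omega⟩, 0))
        (st.1 (⟨2 * i.val, by have := i.isLt; omega⟩, 0))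

/-- The partition function `f_μ^σ(x)` of the colored stochastic vertex model
with U-turn boundary: the sum of the Boltzmann weights of all states satisfying
the boundary conditions (the weight of a non-admissible state is `0`, and only
finitely many states have nonzero weight, so this is a finite sum over the
admissible states). -/
noncomputable def pf (n L : ℕ) (q s ν t qh : ℂ) (x : Fin n → ℂ)
    (σ : Equiv.Perm (Col n)) (μ : Fin n → ℤ) : ℂ :=
  ∑ᶠ st ∈ {st : St n L | BC n L σ μ st}, stWt n L q s ν t qh x st


/-! ### Auxiliary material -/

/-- Vector on column `c` containing the negative colors of index `≥ m` placed there. -/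
def VV (n L : ℕ) (d : Fin n → Fin L) (m : ℕ) (c : Fin L) : Vec n := fun k =>
  ∑ i : Fin n, if m ≤ i.val ∧ d i = c ∧ k = barC n (posC n i) then 1 else 0

lemma posC_lt (n : ℕ) (i : Fin n) : posC n i < mid n := by
  simp [posC, mid, Fin.lt_def]

lemma mid_lt_bar (n : ℕ) (i : Fin n) : mid n < barC n (posC n i) := by
  have := i.isLt
  simp only [posC, mid, barC, Fin.lt_def]; omega

lemma bar_inj (n : ℕ) (i j : Fin n) : barC n (posC n i) = barC n (posC n j) ↔ i = j := by
  have := i.isLt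
  have := j.isLt
  simp only [posC, barC, Fin.ext_iff]; omega

lemma VV_zero (n L : ℕ) (d : Fin n → Fin L) (m : ℕ) (c : Fin L) (k : Col n)
    (h : ∀ i : Fin n, m ≤ i.val → d i = c → k ≠ barC n (posC n i)) : VV n L d m c k = 0 := by
  unfold VV
  refine Finset.sum_eq_zero fun i _ => ?_
  rw [if_neg]
  rintro ⟨h1, h2, h3⟩
  exact h i h1 h2 h3

lemma VV_le_mid (n L : ℕ) (d : Fin n → Fin L) (m : ℕ) (c : Fin L) (k : Col n)
    (hk : k ≤ mid n) : VV n L d m c k = 0 := by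
  refine VV_zero n L d m c k fun i _ _ h => ?_
  have := mid_lt_bar n i
  rw [h] at hk
  exact absurd hk (not_le.mpr this)

lemma VV_n (n L : ℕ) (d : Fin n → Fin L) (c : Fin L) : VV n L d n c = fun _ => 0 := by
  funext k
  refine VV_zero n L d n c k fun i h => ?_
  have := i.isLt
  omega

lemma VV_step (n L : ℕ) (d : Fin n → Fin L) (i : Fin n) (c : Fin L) (k : Col n) :
    VV n L d i.val c k
      = VV n L d (i.val + 1) c k + if d i = c ∧ k = barC n (posC n i) then 1 else 0 := by
  unfold VV
  have : (if d i = c ∧ k = barC n (posC n i) then 1 else 0)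
      = ∑ j : Fin n, if j = i then (if d i = c ∧ k = barC n (posC n i) then 1 else 0) else 0 := by
    simp
  rw [this, ← Finset.sum_add_distrib]
  refine Finset.sum_congr rfl fun j _ => ?_
  by_cases hji : j = i
  · subst hji; simp
  · have hne : j.val ≠ i.val := fun h => hji (Fin.ext h)
    have : i.val ≤ j.val ↔ i.val + 1 ≤ j.val := by omega
    simp [hji, this]

lemma VV_step_ne (n L : ℕ) (d : Fin n → Fin L) (i : Fin n) (c : Fin L) (hc : d i ≠ c) :
    VV n L d i.val c = VV n L d (i.val + 1) c := by
  funext k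
  rw [VV_step]; simp [hc]

lemma VV_step_eq (n L : ℕ) (d : Fin n → Fin L) (i : Fin n) (k : Col n) :
    VV n L d i.val (d i) k
      = VV n L d (i.val + 1) (d i) k + eV n (barC n (posC n i)) k := by
  rw [VV_step]
  have := (mid_lt_bar n i).ne'
  simp [eV, this]

lemma VV_beyond (n L : ℕ) (d : Fin n → Fin L) (hd : ∀ i j : Fin n, i ≤ j → d j ≤ d i)
    (i : Fin n) (m : ℕ) (hm : i.val ≤ m) (c : Fin L) (hc : d i < c) :
    VV n L d m c = fun _ => 0 := by
  funext k
  refine VV_zero n L d m c k fun j hj hdj _ => ?_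
  have := hd i j (by rw [Fin.le_def]; omega)
  rw [hdj] at this
  exact absurd hc (not_lt.mpr this)

lemma VV_ge_bar (n L : ℕ) (d : Fin n → Fin L) (i : Fin n) (c : Fin L) (k : Col n)
    (hk : barC n (posC n i) ≤ k) : VV n L d (i.val + 1) c k = 0 := by
  refine VV_zero n L d _ c k fun j hj _ h => ?_
  subst h
  have := j.isLt
  simp only [posC, barC, Fin.le_def] at hk
  omega

lemma VV_sHi (n L : ℕ) (d : Fin n → Fin L) (m : ℕ) (c : Fin L) :
    sHi n (VV n L d m c) = (Finset.univ.filter (fun j : Fin n => m ≤ j.val ∧ d j = c)).card := by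
  unfold sHi VV
  rw [Finset.sum_comm, Finset.card_filter]
  refine Finset.sum_congr rfl fun j _ => ?_
  by_cases h : m ≤ j.val ∧ d j = c
  · rw [if_pos h, Finset.sum_eq_single (barC n (posC n j))]
    · simp [h]
    · intro b _ hb; simp [hb]
    · intro hb; exact absurd (by simp [mid_lt_bar]) hb
  · rw [if_neg h]
    refine Finset.sum_eq_zero fun k _ => if_neg ?_
    rintro ⟨h1, h2, _⟩
    exact h ⟨h1, h2⟩

lemma eV_mid (n : ℕ) (k : Col n) : eV n (mid n) k = 0 := by simp [eV]

lemma eV_self (n : ℕ) (c : Col n) (hc : c ≠ mid n) : eV n c c = 1 := by simp [eV, hc]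

lemma eV_pos (n : ℕ) (c k : Col n) (h : eV n c k ≠ 0) : c = k := by
  unfold eV at h
  split_ifs at h with h1
  · exact h1.2.symm
  · exact absurd rfl h

/-- The unique horizontal configuration. -/
def hor (n L : ℕ) (d : Fin n → Fin L) (r : Fin (2*n)) (p : Fin (L+1)) : Col n :=
  if r.val % 2 = 0 then
    if p.val ≤ (d ⟨r.val / 2, by have := r.isLt; omega⟩).val then
      barC n (posC n ⟨r.val / 2, by have := r.isLt; omega⟩)
    else mid n
  else posC n ⟨r.val / 2, by have := r.isLt; omega⟩

/-- The unique admissible state. -/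
def st0 (n L : ℕ) (d : Fin n → Fin L) : St n L :=
  (fun rp => hor n L d rp.1 rp.2, fun vc => VV n L d ((vc.1.val + 1) / 2) vc.2)

lemma gamma_row (n L : ℕ) (i : Fin n) (h : Fin (L+1) → Col n) (top bot : Fin L → Vec n)
    (hcons : ∀ c k, bot c k + eV n (h c.succ) k = top c k + eV n (h c.castSucc) k)
    (htop : ∀ c, top c (posC n i) = 0) (hlast : h (Fin.last L) = posC n i) :
    (∀ p, h p = posC n i) ∧ bot = top := by
  have h1 : ∀ p, h p = posC n i := by
    intro p
    induction p using Fin.reverseInduction with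
    | last => exact hlast
    | cast c ih =>
      have := hcons c (posC n i)
      rw [htop, ih, eV_self n _ (posC_lt n i).ne] at this
      exact eV_pos n _ _ (by omega)
  refine ⟨h1, ?_⟩
  funext c k
  have := hcons c k
  rw [h1, h1] at this
  omega

lemma delta_row (n L : ℕ) (d : Fin n → Fin L) (hd : ∀ i j : Fin n, i ≤ j → d j ≤ d i)
    (i : Fin n) (h : Fin (L+1) → Col n) (top bot : Fin L → Vec n)
    (hcons : ∀ c k, bot c k + eV n (h c.castSucc) k = top c k + eV n (h c.succ) k)
    (htop : top = VV n L d i.val) (hlast : h (Fin.last L) = mid n)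
    (h0 : h 0 = posC n i ∨ h 0 = barC n (posC n i)) :
    (∀ p, h p = if p.val ≤ (d i).val then barC n (posC n i) else mid n) ∧
      bot = VV n L d (i.val + 1) := by
  have h0' : h 0 = barC n (posC n i) := by
    refine h0.resolve_left fun hp => ?_
    have : ∀ p, h p = posC n i := by
      intro p
      induction p using Fin.induction with
      | zero => exact hp
      | succ c ih =>
        have := hcons c (posC n i)
        rw [htop, VV_le_mid n L d _ c _ (posC_lt n i).le, ih, eV_self n _ (posC_lt n i).ne] at this
        exact eV_pos n _ _ (by omega)
    have h2 := this (Fin.last L)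
    rw [hlast] at h2
    exact (posC_lt n i).ne h2.symm
  have hlow : ∀ p : Fin (L+1), p.val ≤ (d i).val → h p = barC n (posC n i) := by
    intro p
    induction p using Fin.induction with
    | zero => exact fun _ => h0'
    | succ c ih =>
      intro hc
      simp only [Fin.val_succ] at hc
      have h1 := ih (by simp only [Fin.val_castSucc]; omega)
      have h2 := hcons c (barC n (posC n i))
      have hne : d i ≠ c := by
        intro hh; rw [hh] at hc; omega
      rw [htop, VV_step_ne n L d i c hne, VV_ge_bar n L d i c _ le_rfl, h1,
        eV_self n _ (mid_lt_bar n i).ne'] at h2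
      exact eV_pos n _ _ (by omega)
  have hhigh : ∀ p : Fin (L+1), (d i).val < p.val → h p = mid n := by
    intro p
    induction p using Fin.reverseInduction with
    | last => exact fun _ => hlast
    | cast c ih =>
      intro hc
      simp only [Fin.val_castSucc] at hc
      have h1 := ih (by simp only [Fin.val_succ]; omega)
      by_contra hne
      have h2 := hcons c (h c.castSucc)
      rw [htop, VV_beyond n L d hd i _ le_rfl c hc, h1, eV_self n _ hne, eV_mid] at h2
      simp at h2
  refine ⟨fun p => ?_, ?_⟩
  · split_ifs with hp
    · exact hlow p hp
    · exact hhigh p (by omega)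
  · funext c k
    have h2 := hcons c k
    rcases lt_trichotomy c (d i) with hc | hc | hc
    · have hc' : c.val < (d i).val := hc
      rw [hlow _ (by simp only [Fin.val_castSucc]; omega),
        hlow _ (by simp only [Fin.val_succ]; omega), htop, VV_step_ne n L d i c hc.ne'] at h2
      omega
    · subst hc
      rw [hlow _ (by simp), hhigh _ (by simp), htop, VV_step_eq, eV_mid] at h2
      omega
    · have hc' : (d i).val < c.val := hc
      rw [hhigh _ (by simpa using hc'),
        hhigh _ (by simp only [Fin.val_succ]; omega), htop, VV_step_ne n L d i c hc.ne] at h2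
      omega

lemma LW_cons {n : ℕ} {q s x : ℂ} {I : Vec n} {j : Col n} {K : Vec n} {l : Col n}
    (h : LW n q s x I j K l ≠ 0) : ∀ k, I k + eV n j k = K k + eV n l k := by
  by_contra hc
  exact h (by unfold LW; rw [if_neg hc])

lemma MW_cons {n : ℕ} {q s x : ℂ} {I : Vec n} {j : Col n} {K : Vec n} {l : Col n}
    (h : MW n q s x I j K l ≠ 0) : ∀ k, I k + eV n j k = K k + eV n l k := by
  by_contra hc
  exact h (by unfold MW; rw [if_neg hc])

lemma cap_cases {n : ℕ} {ν t qh x : ℂ} (i : Fin n) {ε' : Col n}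
    (h : capW n ν t qh x (posC n i) ε' ≠ 0) : ε' = posC n i ∨ ε' = barC n (posC n i) := by
  have h1 := posC_lt n i
  unfold capW at h
  rw [if_neg (fun hh => h1.ne hh.1)] at h
  by_contra hc
  push Not at hc
  rw [if_neg (fun hh => hc.2 hh.2), if_neg (fun hh => hc.1 hh.2),
    if_neg (fun hh => hc.2 hh.2), if_neg (fun hh => hc.1 hh.2)] at h
  exact h rfl

lemma topV_eq (n L : ℕ) (μ : Fin n → ℤ) (d : Fin n → Fin L)
    (hμ : ∀ i, μ i = -(((d i).val : ℤ) + 1)) (c : Fin L) : topV n L μ c = VV n L d 0 c := by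
  funext k
  unfold topV VV
  refine Finset.sum_congr rfl fun i _ => ?_
  have h1 : ¬ (μ i = (c.val : ℤ) + 1 ∧ k = posC n i) := by
    rintro ⟨h, _⟩
    rw [hμ] at h; omega
  have h2 : μ i = -((c.val : ℤ) + 1) ↔ d i = c := by
    rw [hμ, Fin.ext_iff]; omega
  rw [if_neg h1]
  simp only [h2, zero_add, Nat.zero_le, true_and]

lemma st_unique (n L : ℕ) (q s ν t qh : ℂ) (x : Fin n → ℂ) (μ : Fin n → ℤ) (d : Fin n → Fin L)
    (hμ : ∀ i, μ i = -(((d i).val : ℤ) + 1)) (hd : ∀ i j : Fin n, i ≤ j → d j ≤ d i)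
    (st : St n L) (hbc : BC n L (Equiv.refl _) μ st) (hw : stWt n L q s ν t qh x st ≠ 0) :
    st = st0 n L d := by
  obtain ⟨hb1, hb2, hb3⟩ := hbc
  unfold stWt at hw
  have hv := (left_ne_zero_of_mul hw)
  have hcap := (right_ne_zero_of_mul hw)
  rw [Finset.prod_ne_zero_iff] at hv hcap
  have hv' := fun r => Finset.prod_ne_zero_iff.mp (hv r (Finset.mem_univ r))
  -- one row pair at a time
  have step : ∀ i : Fin n, (fun c => st.2 (⟨2 * i.val, by have := i.isLt; omega⟩, c)) = VV n L d i.val →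
      (∀ p, st.1 (⟨2 * i.val, by have := i.isLt; omega⟩, p)
        = if p.val ≤ (d i).val then barC n (posC n i) else mid n) ∧
      (∀ p, st.1 (⟨2 * i.val + 1, by have := i.isLt; omega⟩, p) = posC n i) ∧
      (fun c => st.2 (⟨2 * i.val + 1, by have := i.isLt; omega⟩, c)) = VV n L d (i.val + 1) ∧
      (fun c => st.2 (⟨2 * i.val + 2, by have := i.isLt; omega⟩, c)) = VV n L d (i.val + 1) := by
    intro i htop
    have hi := i.isLt
    have hE : ∀ c k, st.2 (⟨2 * i.val + 1, by omega⟩, c) k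
          + eV n (st.1 (⟨2 * i.val, by omega⟩, c.castSucc)) k
        = st.2 (⟨2 * i.val, by omega⟩, c) k + eV n (st.1 (⟨2 * i.val, by omega⟩, c.succ)) k := by
      intro c
      have := hv' ⟨2 * i.val, by omega⟩ c (Finset.mem_univ c)
      rw [if_pos (by simp)] at this
      exact MW_cons this
    have hO : ∀ c k, st.2 (⟨2 * i.val + 2, by omega⟩, c) k
          + eV n (st.1 (⟨2 * i.val + 1, by omega⟩, c.succ)) k
        = st.2 (⟨2 * i.val + 1, by omega⟩, c) k
          + eV n (st.1 (⟨2 * i.val + 1, by omega⟩, c.castSucc)) k := by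
      intro c
      have := hv' ⟨2 * i.val + 1, by omega⟩ c (Finset.mem_univ c)
      rw [if_neg (show ¬ (2 * i.val + 1) % 2 = 0 by omega)] at this
      exact LW_cons this
    have hlE : st.1 (⟨2 * i.val, by omega⟩, Fin.last L) = mid n := by
      rw [hb1, if_pos (by simp)]
    have hlO : st.1 (⟨2 * i.val + 1, by omega⟩, Fin.last L) = posC n i := by
      rw [hb1, if_neg (show ¬ (2 * i.val + 1) % 2 = 0 by omega)]
      simp only [Equiv.refl_apply]
      congr 1
      apply Fin.ext
      change (2 * i.val + 1) / 2 = i.val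
      omega
    have hmidpos : ∀ c, st.2 (⟨2 * i.val + 1, by omega⟩, c) (posC n i) = 0 := by
      have key : ∀ p : Fin (L+1), eV n (st.1 (⟨2 * i.val, by omega⟩, p)) (posC n i) = 0 := by
        intro p
        induction p using Fin.reverseInduction with
        | last => rw [hlE, eV_mid]
        | cast c ih =>
          have h1 := hE c (posC n i)
          have h2 := congrFun (congrFun htop c) (posC n i)
          rw [h2, VV_le_mid n L d _ c _ (posC_lt n i).le, ih] at h1
          omega
      intro c
      have h1 := hE c (posC n i)
      have h2 := congrFun (congrFun htop c) (posC n i)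
      rw [h2, VV_le_mid n L d _ c _ (posC_lt n i).le, key c.castSucc, key c.succ] at h1
      omega
    obtain ⟨g1, g2⟩ := gamma_row n L i (fun p => st.1 (⟨2 * i.val + 1, by omega⟩, p))
      (fun c => st.2 (⟨2 * i.val + 1, by omega⟩, c))
      (fun c => st.2 (⟨2 * i.val + 2, by omega⟩, c)) hO hmidpos hlO
    have hc := hcap i (Finset.mem_univ i)
    rw [g1 0] at hc
    obtain ⟨e1, e2⟩ := delta_row n L d hd i (fun p => st.1 (⟨2 * i.val, by omega⟩, p))
      (fun c => st.2 (⟨2 * i.val, by omega⟩, c))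
      (fun c => st.2 (⟨2 * i.val + 1, by omega⟩, c)) hE htop hlE (cap_cases i hc)
    exact ⟨e1, g1, e2, g2.trans e2⟩
  have lev : ∀ m : ℕ, (hm : m ≤ n) →
      (fun c => st.2 (⟨2 * m, by omega⟩, c)) = VV n L d m := by
    intro m
    induction m with
    | zero =>
      intro _
      funext c
      have := hb2 c
      rw [topV_eq n L μ d hμ] at this
      exact this
    | succ m ih =>
      intro hm
      exact (step ⟨m, by omega⟩ (ih (by omega))).2.2.2
  have hvert : ∀ v c, st.2 (v, c) = VV n L d ((v.val + 1) / 2) c := by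
    intro v c
    have hv := v.isLt
    rcases Nat.even_or_odd' v.val with ⟨m, hm | hm⟩
    · have h1 := congrFun (lev m (by omega)) c
      have h2 : v = ⟨2 * m, by omega⟩ := Fin.ext hm
      have h3 : (v.val + 1) / 2 = m := by omega
      rw [h3, h2]; exact h1
    · have h1 := congrFun (step ⟨m, by omega⟩ (lev m (by omega))).2.2.1 c
      have h2 : v = ⟨2 * m + 1, by omega⟩ := Fin.ext hm
      have h3 : (v.val + 1) / 2 = m + 1 := by omega
      rw [h3, h2]; exact h1
  have hhor : ∀ r p, st.1 (r, p) = hor n L d r p := by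
    intro r p
    have hr := r.isLt
    unfold hor
    have h3 := step ⟨r.val / 2, by omega⟩ (lev (r.val / 2) (by omega))
    split_ifs with he hp
    · have h1 := h3.1 p
      have h2 : r = ⟨2 * (r.val / 2), by omega⟩ := Fin.ext (by grind)
      rw [if_pos hp] at h1
      rw [← h1]; exact congrArg (fun r => st.1 (r, p)) h2
    · have h1 := h3.1 p
      have h2 : r = ⟨2 * (r.val / 2), by omega⟩ := Fin.ext (by grind)
      rw [if_neg hp] at h1
      rw [← h1]; exact congrArg (fun r => st.1 (r, p)) h2
    · have h1 := h3.2.1 p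
      have h2 : r = ⟨2 * (r.val / 2) + 1, by omega⟩ := Fin.ext (by grind)
      rw [← h1]; exact congrArg (fun r => st.1 (r, p)) h2
  refine Prod.ext ?_ ?_
  · funext ⟨r, p⟩; exact hhor r p
  · funext ⟨v, c⟩; exact hvert v c

lemma st0_BC (n L : ℕ) (μ : Fin n → ℤ) (d : Fin n → Fin L)
    (hμ : ∀ i, μ i = -(((d i).val : ℤ) + 1)) : BC n L (Equiv.refl _) μ (st0 n L d) := by
  refine ⟨fun r => ?_, fun c => ?_, fun c => ?_⟩
  · simp only [st0, hor, Equiv.refl_apply, Fin.val_last]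
    rw [if_neg (show ¬ L ≤ _ by have := (d ⟨r.val / 2, by have := r.isLt; omega⟩).isLt; omega)]
  · rw [topV_eq n L μ d hμ]; simp [st0]
  · simp only [st0, Fin.val_last]
    rw [show (2 * n + 1) / 2 = n by omega, VV_n]

lemma prod_pairs (n : ℕ) (F : Fin (2*n) → ℂ) :
    ∏ r, F r = ∏ i : Fin n, (F ⟨2 * i.val, by have := i.isLt; omega⟩
      * F ⟨2 * i.val + 1, by have := i.isLt; omega⟩) := by
  induction n with
  | zero => simp
  | succ n ih =>
    rw [Fin.prod_univ_castSucc (n := n)]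
    have : ∏ r, F r = (∏ r : Fin (2*n), F ⟨r.val, by have := r.isLt; omega⟩)
        * F ⟨2 * n, by omega⟩ * F ⟨2 * n + 1, by omega⟩ := by
      change ∏ r : Fin (2*n+1+1), F r = _
      rw [Fin.prod_univ_castSucc, Fin.prod_univ_castSucc]
      rfl
    rw [this, ih, mul_assoc]
    rfl

lemma sum_filter_zero {n : ℕ} (I : Vec n) (P : Col n → Prop) [DecidablePred P]
    (h : ∀ k, P k → I k = 0) : ∑ k ∈ Finset.univ.filter P, I k = 0 :=
  Finset.sum_eq_zero fun k hk => h k (Finset.mem_filter.mp hk).2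

lemma LW_val (n L : ℕ) (q s x : ℂ) (d : Fin n → Fin L) (i : Fin n) (m : ℕ) (c : Fin L) :
    LW n q s x (VV n L d m c) (posC n i) (VV n L d m c) (posC n i)
      = (s - x) / (s * (1 - s * x)) := by
  have h1 := posC_lt n i
  have h2 : sLe n (VV n L d m c) (posC n i) = 0 :=
    sum_filter_zero _ _ fun k hk => VV_le_mid n L d m c k (hk.trans h1.le)
  unfold LW
  rw [if_pos (fun _ => rfl), if_pos rfl, if_neg h1.ne, if_pos h1, h2, VV_le_mid n L d m c _ h1.le]
  simp

lemma MW_val_low (n L : ℕ) (q s x : ℂ) (hs : s ≠ 0) (d : Fin n → Fin L) (i : Fin n) (c : Fin L) :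
    MW n q s x (VV n L d (i.val + 1) c) (barC n (posC n i)) (VV n L d (i.val + 1) c)
        (barC n (posC n i))
      = (s - x) / (s * (1 - s * x)) := by
  have h1 := mid_lt_bar n i
  have h2 : sGt n (VV n L d (i.val + 1) c) (barC n (posC n i)) = 0 :=
    sum_filter_zero _ _ fun k hk => VV_ge_bar n L d i c k hk.le
  unfold MW
  rw [if_pos (fun _ => rfl), if_pos rfl, if_neg h1.ne', if_neg h1.not_gt, h2,
    VV_ge_bar n L d i c _ le_rfl]
  rw [← div_div]
  congr 1
  simp
  field_simp

lemma MW_val_mid (n L : ℕ) (q s x : ℂ) (hs : s ≠ 0) (d : Fin n → Fin L) (i : Fin n) :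
    MW n q s x (VV n L d (i.val + 1) (d i)) (barC n (posC n i)) (VV n L d i.val (d i)) (mid n)
      = (-(s * x) / (1 - s * x)) * (1 - q ^ (-(((Finset.univ.filter
          (fun j : Fin n => i < j ∧ d j = d i)).card : ℕ) : ℤ)) * (s ^ 2)⁻¹) := by
  have h1 := mid_lt_bar n i
  have h2 : sLo n (VV n L d (i.val + 1) (d i)) = 0 :=
    sum_filter_zero _ _ fun k hk => VV_le_mid n L d _ _ k (le_of_lt hk)
  have h3 : (Finset.univ.filter (fun j : Fin n => i.val + 1 ≤ j.val ∧ d j = d i))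
      = Finset.univ.filter (fun j : Fin n => i < j ∧ d j = d i) := rfl
  unfold MW
  rw [if_pos (fun k => by rw [VV_step_eq, eV_mid]; rfl), if_neg h1.ne', if_neg h1.not_gt,
    if_pos rfl, h2, VV_sHi, h3]
  generalize q ^ (-(((Finset.univ.filter
          (fun j : Fin n => i < j ∧ d j = d i)).card : ℕ) : ℤ)) = Q
  simp only [Nat.cast_zero, zpow_zero]
  rw [div_mul_eq_mul_div]
  congr 1
  field_simp
  ring

lemma MW_val_high (n : ℕ) (q s x : ℂ) (hsx : 1 - s * x ≠ 0) :
    MW n q s x (fun _ => 0) (mid n) (fun _ => 0) (mid n) = 1 := by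
  unfold MW
  simp [sHi, sLo, hsx]

lemma prod_count {n : ℕ} (f : ℕ → ℂ) (S : Finset (Fin n)) :
    ∏ i ∈ S, f ((S.filter (fun j => i < j)).card) = ∏ k ∈ Finset.range S.card, f k := by
  induction S using Finset.induction_on_min with
  | empty => simp
  | insert a S ha ih =>
    have hna : a ∉ S := fun h => lt_irrefl _ (ha a h)
    rw [Finset.prod_insert hna, Finset.card_insert_of_notMem hna, Finset.prod_range_succ, mul_comm]
    congr 1
    · rw [← ih]
      refine Finset.prod_congr rfl fun i hi => ?_
      rw [Finset.filter_insert, if_neg (ha i hi).not_gt]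
    · rw [Finset.filter_insert, if_neg (lt_irrefl a), Finset.filter_true_of_mem ha]

lemma delta_weight (n L : ℕ) (q s : ℂ) (x : ℂ) (hs : s ≠ 0) (hsx : 1 - s * x ≠ 0)
    (d : Fin n → Fin L) (hd : ∀ i j : Fin n, i ≤ j → d j ≤ d i) (i : Fin n) :
    ∏ c : Fin L, MW n q s x (VV n L d (i.val + 1) c)
        (if c.val ≤ (d i).val then barC n (posC n i) else mid n) (VV n L d i.val c)
        (if c.val + 1 ≤ (d i).val then barC n (posC n i) else mid n)
      = ((s - x) / (s * (1 - s * x))) ^ (d i).val * ((-(s * x) / (1 - s * x)) *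
        (1 - q ^ (-(((Finset.univ.filter
          (fun j : Fin n => i < j ∧ d j = d i)).card : ℕ) : ℤ)) * (s ^ 2)⁻¹)) := by
  have key : ∀ c : Fin L, MW n q s x (VV n L d (i.val + 1) c)
        (if c.val ≤ (d i).val then barC n (posC n i) else mid n) (VV n L d i.val c)
        (if c.val + 1 ≤ (d i).val then barC n (posC n i) else mid n)
      = (if c < d i then (s - x) / (s * (1 - s * x)) else 1) *
        (if c = d i then ((-(s * x) / (1 - s * x)) *
        (1 - q ^ (-(((Finset.univ.filter
          (fun j : Fin n => i < j ∧ d j = d i)).card : ℕ) : ℤ)) * (s ^ 2)⁻¹)) else 1) := by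
    intro c
    rcases lt_trichotomy c (d i) with hc | hc | hc
    · have hc' : c.val < (d i).val := hc
      rw [if_pos hc'.le, if_pos (show c.val + 1 ≤ (d i).val from hc'), if_pos hc, if_neg hc.ne, mul_one,
        VV_step_ne n L d i c hc.ne', MW_val_low n L q s x hs]
    · subst hc
      rw [if_pos le_rfl, if_neg (by omega), if_neg (lt_irrefl _), if_pos rfl, one_mul,
        MW_val_mid n L q s x hs]
    · have hc' : (d i).val < c.val := hc
      rw [if_neg (by omega), if_neg (by omega), if_neg hc.not_gt, if_neg hc.ne', mul_one,
        VV_beyond n L d hd i _ le_rfl c hc, VV_beyond n L d hd i _ (Nat.le_succ _) c hc,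
        MW_val_high n q s x hsx]
  rw [Finset.prod_congr rfl fun c _ => key c, Finset.prod_mul_distrib]
  congr 1
  · rw [Finset.prod_ite, Finset.prod_const, Finset.prod_const_one, mul_one]
    congr 1
    have : Finset.univ.filter (fun c : Fin L => c < d i) = Finset.Iio (d i) := by
      ext c; simp
    rw [this, Fin.card_Iio]
  · simp

lemma st0_weight (n L : ℕ) (q s ν t qh : ℂ) (x : Fin n → ℂ) (hs : s ≠ 0)
    (hsx : ∀ i, 1 - s * x i ≠ 0)
    (d : Fin n → Fin L) (hd : ∀ i j : Fin n, i ≤ j → d j ≤ d i) :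
    stWt n L q s ν t qh x (st0 n L d)
      = (∏ i : Fin n, ((((s - x i) / (s * (1 - s * x i))) ^ (d i).val * ((-(s * x i) / (1 - s * x i)) *
        (1 - q ^ (-(((Finset.univ.filter
          (fun j : Fin n => i < j ∧ d j = d i)).card : ℕ) : ℤ)) * (s ^ 2)⁻¹))) *
          ((s - x i) / (s * (1 - s * x i))) ^ L)) *
        ∏ i : Fin n, (t * phiF ν t (qh * (x i)⁻¹)) := by
  unfold stWt
  rw [prod_pairs]
  congr 1
  · refine Finset.prod_congr rfl fun i _ => ?_
    have hi := i.isLt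
    have e1 : (2 * i.val) / 2 = i.val := by omega
    have e2 : (2 * i.val + 1) / 2 = i.val := by omega
    have e3 : (2 * i.val + 1 + 1) / 2 = i.val + 1 := by omega
    have e4 : (2 * i.val + 1 + 1 + 1) / 2 = i.val + 1 := by omega
    have m1 : (2 * i.val) % 2 = 0 := by omega
    have m2 : ¬ (2 * i.val + 1) % 2 = 0 := by omega
    congr 1
    · rw [← delta_weight n L q s (x i) hs (hsx i) d hd i]
      refine Finset.prod_congr rfl fun c _ => ?_
      simp only [st0, hor, m1, if_true, Fin.val_succ, Fin.val_castSucc, e1, e2, e3, Fin.eta]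
    · rw [← Fin.prod_const]
      refine Finset.prod_congr rfl fun c _ => ?_
      rw [← LW_val n L q s (x i) d i (i.val + 1) c]
      simp only [st0, hor, m2, if_false, Fin.val_succ, Fin.val_castSucc, e2, e3, e4, Fin.eta]
  · refine Finset.prod_congr rfl fun i _ => ?_
    have e1 : (2 * i.val) / 2 = i.val := by omega
    have e2 : (2 * i.val + 1) / 2 = i.val := by omega
    have m1 : (2 * i.val) % 2 = 0 := by omega
    have m2 : ¬ (2 * i.val + 1) % 2 = 0 := by omega
    simp only [st0, hor, m1, m2, if_true, if_false, e1, e2, Fin.eta, Fin.val_zero, Nat.zero_le]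
    have h1 := posC_lt n i
    unfold capW
    rw [if_neg (fun hh => h1.ne hh.1), if_pos ⟨h1, rfl⟩]

/-- Theorem 3.1: evaluation of the partition function for the
special boundary conditions `σ = Id`, all `μ_i` negative and
`|μ_1| ≥ |μ_2| ≥ ⋯ ≥ |μ_n|`. -/
theorem partition_function_special_boundary (n L : ℕ) (hn : 0 < n) (hL : 0 < L)
    (q s ν t qh : ℂ) (x : Fin n → ℂ)
    (hq : q ≠ 0) (hs : s ≠ 0) (hν : ν ≠ 0) (hqh : qh ^ 2 * q = 1)
    (hx0 : ∀ i, x i ≠ 0) (hsx : ∀ i, 1 - s * x i ≠ 0)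
    (hc1 : ∀ i, 1 - ν * t * (qh * (x i)⁻¹) ≠ 0)
    (hc2 : ∀ i, 1 + ν⁻¹ * (qh * (x i)⁻¹) ≠ 0)
    (μ : Fin n → ℤ)
    (hμrange : ∀ i, -(L : ℤ) ≤ μ i ∧ μ i ≤ -1)
    (hμmono : ∀ i j : Fin n, i ≤ j → |μ j| ≤ |μ i|) :
    pf n L q s ν t qh x (Equiv.refl (Col n)) μ
      = t ^ n * (∏ i : Fin n, phiF ν t (qh * (x i)⁻¹))
        * (∏ i : Fin n, ((s - x i) / (s * (1 - s * x i))) ^ ((L : ℤ) - μ i - 1))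
        * (∏ i : Fin n, -(s * x i) / (1 - s * x i))
        * (∏ c : Fin L,
            ∏ k ∈ Finset.range
              ((Finset.univ.filter (fun i : Fin n => μ i = -((c.val : ℤ) + 1))).card),
              (1 - q ^ (-(k : ℤ)) * (s ^ 2)⁻¹)) := by
  have hex : ∀ i, ∃ c : Fin L, μ i = -((c.val : ℤ) + 1) := by
    intro i
    have h := hμrange i
    exact ⟨⟨(-(μ i) - 1).toNat, by omega⟩, by simp only; omega⟩
  choose d hμ using hex
  have hd : ∀ i j : Fin n, i ≤ j → d j ≤ d i := by
    intro i j hij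
    have h := hμmono i j hij
    rw [hμ i, hμ j, abs_neg, abs_neg, abs_of_nonneg (by omega), abs_of_nonneg (by omega)] at h
    rw [Fin.le_def]; omega
  have hpf : pf n L q s ν t qh x (Equiv.refl (Col n)) μ
      = stWt n L q s ν t qh x (st0 n L d) := by
    classical
    unfold pf
    rw [finsum_eq_single _ (st0 n L d)]
    · exact finsum_eq_if.trans (if_pos (st0_BC n L μ d hμ))
    · intro st hst
      by_cases hb : BC n L (Equiv.refl (Col n)) μ st
      · refine finsum_eq_if.trans ((if_pos hb).trans ?_)
        by_contra hw
        exact hst (st_unique n L q s ν t qh x μ d hμ hd st hb hw)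
      · exact finsum_eq_if.trans (if_neg hb)
  rw [hpf, st0_weight n L q s ν t qh x hs hsx d hd]
  have hcount : (∏ c : Fin L, ∏ k ∈ Finset.range
        ((Finset.univ.filter (fun i : Fin n => μ i = -((c.val : ℤ) + 1))).card),
        (1 - q ^ (-(k : ℤ)) * (s ^ 2)⁻¹))
      = ∏ i : Fin n, (1 - q ^ (-(((Finset.univ.filter
          (fun j : Fin n => i < j ∧ d j = d i)).card : ℕ) : ℤ)) * (s ^ 2)⁻¹) := by
    rw [← Finset.prod_fiberwise (s := Finset.univ) (g := d)]
    refine Finset.prod_congr rfl fun c _ => ?_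
    have hS : (Finset.univ.filter (fun i : Fin n => μ i = -((c.val : ℤ) + 1)))
        = Finset.univ.filter (fun i : Fin n => d i = c) := by
      ext i
      simp only [Finset.mem_filter, Finset.mem_univ, true_and]
      rw [hμ, Fin.ext_iff]; omega
    rw [hS, ← prod_count (fun k : ℕ => (1 - q ^ (-(k : ℤ)) * (s ^ 2)⁻¹))]
    refine Finset.prod_congr rfl fun i hi => ?_
    have hi' : d i = c := (Finset.mem_filter.mp hi).2
    rw [Finset.filter_filter, hi']
    simp only [and_comm]
  have hpow : ∀ i, ((s - x i) / (s * (1 - s * x i))) ^ ((L : ℤ) - μ i - 1)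
      = ((s - x i) / (s * (1 - s * x i))) ^ (d i).val * ((s - x i) / (s * (1 - s * x i))) ^ L := by
    intro i
    rw [← pow_add, ← zpow_natCast]
    congr 1
    rw [hμ]; push_cast; ring
  rw [hcount, Finset.prod_congr rfl fun i _ => hpow i]
  simp only [Finset.prod_mul_distrib, Finset.prod_const, Finset.card_univ, Fintype.card_fin]
  ring
end
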